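/- arXiv:1003.2019 — 4 statements merged into one kernel-verified Lean document; each statement's English description precedes it below -/
import Mathlib

section
/- Let λ ∈ (−π/2, π/2) with cos λ < 1/√2 (i.e., 2 cos² λ < 1). Then the improper integral ∫₀¹ exp(sin(2λ) · arcsin(t sin λ)) / (√(1 − t² sin² λ) − t cos λ)^{2 cos² λ} dt is finite. -/
/-- If `cos λ < 1/√2` (i.e. `2 cos² λ < 1`), then
`∫₀¹ exp(sin(2λ)·arcsin(t sin λ)) / (√(1 − t² sin² λ) − t cos λ)^(2 cos² λ) dt` is finite. -/
theorem integrand_integrable (lam : ℝ)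
    (hlam : lam ∈ Set.Ioo (-(Real.pi / 2)) (Real.pi / 2))
    (hcos : Real.cos lam < 1 / Real.sqrt 2) :
    MeasureTheory.IntegrableOn
      (fun t : ℝ =>
        Real.exp (Real.sin (2 * lam) * Real.arcsin (t * Real.sin lam)) /
          (Real.sqrt (1 - t ^ 2 * Real.sin lam ^ 2) -
            t * Real.cos lam) ^ (2 * Real.cos lam ^ 2))
      (Set.Ico (0 : ℝ) 1) MeasureTheory.volume := by
  have hc0 : 0 < Real.cos lam := Real.cos_pos_of_mem_Ioo hlam
  have hp : 2 * Real.cos lam ^ 2 < 1 := by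
    have h2 : (0 : ℝ) < Real.sqrt 2 := by positivity
    have h3 : Real.cos lam * Real.sqrt 2 < 1 := by rwa [lt_div_iff₀ h2] at hcos
    have h4 : Real.sqrt 2 ^ 2 = 2 := Real.sq_sqrt (by norm_num)
    have h5 : (Real.cos lam * Real.sqrt 2) ^ 2 < 1 := by
      have : 0 < Real.cos lam * Real.sqrt 2 := by positivity
      nlinarith
    rw [mul_pow, h4] at h5
    linarith
  have hp0 : 0 ≤ 2 * Real.cos lam ^ 2 := by positivity
  have hc1 : Real.cos lam ≤ 1 := Real.cos_le_one lam
  have hsc := Real.sin_sq_add_cos_sq lam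
  generalize 2 * Real.cos lam ^ 2 = p at hp hp0 ⊢
  have hint : MeasureTheory.IntegrableOn
      (fun t : ℝ => Real.exp (Real.pi / 2) * (1 - t) ^ (-p)) (Set.Ico (0 : ℝ) 1)
      MeasureTheory.volume := by
    have h1 : IntervalIntegrable (fun x : ℝ => x ^ (-p)) MeasureTheory.volume 0 1 :=
      intervalIntegral.intervalIntegrable_rpow' (by linarith)
    have h2 := (h1.comp_sub_left 1).symm
    simp only [sub_zero, sub_self] at h2
    rw [intervalIntegrable_iff_integrableOn_Ico_of_le zero_le_one] at h2
    exact h2.const_mul _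
  refine MeasureTheory.Integrable.mono' hint ?_ ?_
  · apply Measurable.aestronglyMeasurable
    have := Real.measurable_arcsin
    fun_prop
  · refine (MeasureTheory.ae_restrict_iff' measurableSet_Ico).2 (Filter.Eventually.of_forall ?_)
    rintro t ⟨ht0, ht1⟩
    have hD : 1 - t ≤ Real.sqrt (1 - t ^ 2 * Real.sin lam ^ 2) - t * Real.cos lam := by
      have : 1 - t + t * Real.cos lam ≤ Real.sqrt (1 - t ^ 2 * Real.sin lam ^ 2) := by
        apply Real.le_sqrt_of_sq_le
        have hs : Real.sin lam ^ 2 = 1 - Real.cos lam ^ 2 := by linarith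
        rw [hs]
        have : 0 ≤ t * (1 - t) * (1 - Real.cos lam) :=
          mul_nonneg (mul_nonneg ht0 (by linarith)) (by linarith)
        nlinarith
      linarith
    have hpos : 0 < 1 - t := by linarith
    have hDpos := lt_of_lt_of_le hpos hD
    have hE : Real.sin (2 * lam) * Real.arcsin (t * Real.sin lam) ≤ Real.pi / 2 := by
      refine (le_abs_self _).trans ?_
      rw [abs_mul]
      have h1 := Real.abs_sin_le_one (2 * lam)
      have h2 : |Real.arcsin (t * Real.sin lam)| ≤ Real.pi / 2 :=
        abs_le.2 ⟨Real.neg_pi_div_two_le_arcsin _, Real.arcsin_le_pi_div_two _⟩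
      calc _ ≤ 1 * (Real.pi / 2) := mul_le_mul h1 h2 (abs_nonneg _) zero_le_one
        _ = _ := one_mul _
    rw [Real.norm_of_nonneg (div_nonneg (Real.exp_pos _).le (Real.rpow_nonneg hDpos.le _)),
      Real.rpow_neg hpos.le, ← div_eq_mul_inv]
    exact div_le_div₀ (Real.exp_pos _).le (Real.exp_le_exp.2 hE) (Real.rpow_pos_of_pos hpos _)
      (Real.rpow_le_rpow hpos.le hD hp0)
end

section
/- Let λ ∈ (−π/2, π/2) with 0 < cos λ < 1/2, let q ∈ (−1, 0], and let f be analytic on the unit disk 𝔻 with f(0) = 0, f'(0) = 1, f'(z) ≠ 0 on 𝔻 and f(z) ≠ 0 for z ≠ 0. If Re(e^{−iλ}(1 + z f''(z)/f'(z) + q · z f'(z)/f(z))) > 0 for all z ∈ 𝔻 (where z f'(z)/f(z) is interpreted as 1 at z = 0), then f is univalent (injective) on 𝔻. -/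
open Metric
open Filter Topology

lemma aux_partials {K : ℂ × ℂ → ℂ} {p : ℂ × ℂ} {A B : ℂ} (hK : AnalyticAt ℂ K p)
    (hA : HasDerivAt (fun u => K (u, p.2)) A p.1) (hB : HasDerivAt (fun z => K (p.1, z)) B p.2) :
    fderiv ℂ K p (1, 0) = A ∧ fderiv ℂ K p (0, 1) = B := by
  have h := hK.differentiableAt.hasFDerivAt
  constructor
  · have h1 : HasDerivAt (fun u : ℂ => (u, p.2)) ((1 : ℂ), (0 : ℂ)) p.1 :=
      (hasDerivAt_id p.1).prodMk (hasDerivAt_const p.1 p.2)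
    exact (HasFDerivAt.comp_hasDerivAt p.1 (by simpa using h) h1).unique hA
  · have h1 : HasDerivAt (fun z : ℂ => (p.1, z)) ((0 : ℂ), (1 : ℂ)) p.2 :=
      (hasDerivAt_const p.2 p.1).prodMk (hasDerivAt_id p.2)
    exact (HasFDerivAt.comp_hasDerivAt p.2 (by simpa using h) h1).unique hB

lemma aux_inj {K : ℂ × ℂ → ℂ} {p : ℂ × ℂ} {B : ℂ} (hK : AnalyticAt ℂ K p)
    (hB : HasDerivAt (fun z => K (p.1, z)) B p.2) (hB0 : B ≠ 0) :
    ∀ᶠ x : (ℂ × ℂ) × (ℂ × ℂ) in 𝓝 (p, p), x.1.1 = x.2.1 → K x.1 = K x.2 → x.1.2 = x.2.2 := by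
  have h := hK.hasStrictFDerivAt
  have h1 : fderiv ℂ K p (0, 1) = B := by
    have h1 : HasDerivAt (fun z : ℂ => (p.1, z)) ((0 : ℂ), (1 : ℂ)) p.2 :=
      (hasDerivAt_const p.2 p.1).prodMk (hasDerivAt_id p.2)
    exact (HasFDerivAt.comp_hasDerivAt p.2 (by simpa using h.hasFDerivAt) h1).unique hB
  have hpos : 0 < ‖B‖ / 2 := by positivity
  filter_upwards [h.isLittleO.def hpos] with x hx e1 e2
  have e3 : x.1 - x.2 = (x.1.2 - x.2.2) • ((0 : ℂ), (1 : ℂ)) := by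
    ext <;> simp [e1]
  rw [e2, e3, map_smul, h1, norm_smul] at hx
  simp [Prod.norm_def] at hx
  by_contra hne
  have : 0 < ‖x.1.2 - x.2.2‖ := norm_pos_iff.mpr (sub_ne_zero.mpr hne)
  have : 0 < ‖B‖ := norm_pos_iff.mpr hB0
  nlinarith [mul_pos ‹0 < ‖B‖› ‹0 < ‖x.1.2 - x.2.2‖›]

lemma aux_re {D : ℂ} (hD : ‖D - 1‖ < 1) : 1 / 2 < (1 / D).re := by
  have h : Complex.normSq (D - 1) < 1 := by
    rw [Complex.normSq_eq_norm_sq]; nlinarith [norm_nonneg (D - 1)]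
  have h0 : D ≠ 0 := by rintro rfl; simp at hD
  have hn : 0 < Complex.normSq D := Complex.normSq_pos.mpr h0
  rw [one_div D, Complex.inv_re, lt_div_iff₀ hn]
  simp [Complex.normSq_apply] at h ⊢
  nlinarith

lemma aux_move {K : ℂ × ℂ → ℂ} {u₀ : ℝ} {z₀ A B D : ℂ} (hK : AnalyticAt ℂ K ((u₀ : ℂ), z₀))
    (hA : HasDerivAt (fun u => K (u, z₀)) A u₀) (hB : HasDerivAt (fun z => K ((u₀ : ℂ), z)) B z₀)
    (hB0 : B ≠ 0) (hu : 0 < u₀) (hz : z₀ ≠ 0) (hD : ‖D - 1‖ < 1)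
    (hrel : -A * (u₀ * D) = z₀ * B) (V : Set ℂ) (hV : V ∈ 𝓝 z₀) :
    ∀ᶠ u : ℝ in 𝓝[<] u₀, ∃ z ∈ V, K ((u : ℂ), z) = K ((u₀ : ℂ), z₀) ∧
      ‖z‖ ^ 2 * u₀ ≤ ‖z₀‖ ^ 2 * u := by
  obtain ⟨pA, pB⟩ := aux_partials hK hA hB
  have hD0 : D ≠ 0 := by rintro rfl; simp at hD
  have huc : (u₀ : ℂ) ≠ 0 := by exact_mod_cast hu.ne'
  have h := hK.hasStrictFDerivAt
  set K' := fderiv ℂ K ((u₀ : ℂ), z₀) with hK'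
  have hinr : K' ∘L .inr ℂ ℂ ℂ = (ContinuousLinearEquiv.unitsEquivAut ℂ (Units.mk0 B hB0) : ℂ →L[ℂ] ℂ) := by
    ext; simp [pB]
  have hinv : (K' ∘L .inr ℂ ℂ ℂ).IsInvertible := ⟨_, hinr.symm⟩
  set ψ := h.implicitFunctionOfProdDomain hinv with hψ
  have hψ0 : ψ u₀ = z₀ :=
    (h.eventually_apply_eq_iff_implicitFunctionOfProdDomain hinv).self_of_nhds.mp rfl
  have hψt : Tendsto ψ (𝓝 (u₀ : ℂ)) (𝓝 z₀) := h.tendsto_implicitFunctionOfProdDomain hinv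
  have hψe := h.eventually_apply_implicitFunctionOfProdDomain hinv
  have hψd : HasDerivAt ψ (z₀ / (u₀ * D)) u₀ := by
    have := (h.hasStrictFDerivAt_implicitFunctionOfProdDomain hinv).hasFDerivAt.hasDerivAt
    refine this.congr_deriv ?_
    rw [hinr, ContinuousLinearMap.inverse_equiv]
    simp [pA, ContinuousLinearEquiv.unitsEquivAut]
    field_simp
    linear_combination hrel
  have hof : Tendsto (fun u : ℝ => (u : ℂ)) (𝓝[<] u₀) (𝓝 (u₀ : ℂ)) :=
    (Complex.continuous_ofReal.tendsto u₀).mono_left nhdsWithin_le_nhds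
  have hd1 : HasDerivAt (fun u : ℝ => ψ u) (z₀ / (u₀ * D)) u₀ := hψd.comp_ofReal
  have hd2 := hd1.norm_sq
  have hd3 := (hd2.mul_const u₀).sub ((hasDerivAt_id u₀).const_mul (‖z₀‖ ^ 2))
  rw [hψ0] at hd3
  have hpos : 0 < 2 * inner ℝ z₀ (z₀ / (↑u₀ * D)) * u₀ - ‖z₀‖ ^ 2 * 1 := by
    have e : inner ℝ z₀ (z₀ / (↑u₀ * D)) * u₀ = ‖z₀‖ ^ 2 * (1 / D).re := by
      have e1 : z₀ / (↑u₀ * D) = ((u₀⁻¹ : ℝ) : ℂ) * (z₀ * (1 / D)) := by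
        push_cast; field_simp
      rw [e1, Complex.inner, ← Complex.normSq_eq_norm_sq]
      have e2 : ((starRingEnd ℂ) z₀ * ((u₀⁻¹ : ℝ) * (z₀ * (1 / D)))) =
        ((u₀⁻¹ * Complex.normSq z₀ : ℝ) : ℂ) * (1 / D) := by
        push_cast; rw [Complex.normSq_eq_conj_mul_self]; ring
      have e2' := e2
      rw [mul_comm (starRingEnd ℂ z₀)] at e2'
      first | rw [e2] | rw [e2']
      rw [Complex.re_ofReal_mul]
      field_simp
    have := aux_re hD
    have hn : 0 < ‖z₀‖ ^ 2 := by positivity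
    nlinarith
  have hsl := (hasDerivAt_iff_tendsto_slope.mp hd3).eventually (lt_mem_nhds hpos)
  have hsl' := hsl.filter_mono (nhdsWithin_mono u₀ (fun x (hx : x < u₀) => hx.ne))
  filter_upwards [hsl', hof.eventually hψe, hof.eventually (hψt.eventually hV), self_mem_nhdsWithin]
    with u h1 h2 h3 h4
  refine ⟨ψ u, h3, h2, ?_⟩
  simp only [slope_def_field, Pi.sub_apply, id, hψ0] at h1
  have h5 : u - u₀ < 0 := sub_neg.mpr h4
  by_contra hcon
  exact absurd (div_nonpos_of_nonneg_of_nonpos (by linarith) h5.le) (not_le.mpr h1)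

def QQ (W : ℂ → ℂ) (p : ℂ × ℂ) : ℂ := p.1 + (1 - p.1) * W p.2

noncomputable def FF (f W : ℂ → ℂ) (β : ℂ) (p : ℂ × ℂ) : ℂ := f p.2 * (QQ W p) ^ β

def CC (r : ℝ) : Set (ℝ × ℂ) := {p | 0 ≤ p.1 ∧ p.1 ≤ 1 ∧ ‖p.2‖ ^ 2 ≤ r ^ 2 * p.1}

lemma CC_compact {r : ℝ} (hr1 : r < 1) (hr0 : 0 ≤ r) : IsCompact (CC r) := by
  refine IsCompact.of_isClosed_subset
    ((isCompact_Icc (a := (0 : ℝ)) (b := 1)).prod (isCompact_closedBall (0 : ℂ) 1)) ?_ ?_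
  · have c1 : IsClosed {p : ℝ × ℂ | 0 ≤ p.1} := isClosed_le (by fun_prop) (by fun_prop)
    have c2 : IsClosed {p : ℝ × ℂ | p.1 ≤ 1} := isClosed_le (by fun_prop) (by fun_prop)
    have c3 : IsClosed {p : ℝ × ℂ | ‖p.2‖ ^ 2 ≤ r ^ 2 * p.1} :=
      isClosed_le (by fun_prop) (by fun_prop)
    exact c1.inter (c2.inter c3)
  · rintro ⟨u, z⟩ ⟨h1, h2, h3⟩
    simp only at h1 h2 h3
    refine ⟨⟨h1, h2⟩, ?_⟩
    simp only [mem_closedBall, dist_zero_right]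
    have : r ^ 2 * u ≤ 1 := by nlinarith
    nlinarith [norm_nonneg z]

lemma CC_ball {r : ℝ} (hr1 : r < 1) (hr0 : 0 ≤ r) {p : ℝ × ℂ} (hp : p ∈ CC r) :
    p.2 ∈ ball (0 : ℂ) 1 := by
  obtain ⟨h1, h2, h3⟩ := hp
  simp only [mem_ball, dist_zero_right]
  have : r ^ 2 * p.1 < 1 := by nlinarith
  nlinarith [norm_nonneg p.2]

lemma CC_le {r : ℝ} (hr1 : r < 1) (hr0 : 0 ≤ r) {p : ℝ × ℂ} (hp : p ∈ CC r) :
    ‖p.2‖ ^ 2 ≤ p.1 := by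
  obtain ⟨h1, h2, h3⟩ := hp
  have : r ^ 2 ≤ 1 := by nlinarith
  nlinarith [mul_le_mul_of_nonneg_right this h1]

lemma CC_zero {r : ℝ} {p : ℝ × ℂ} (hp : p ∈ CC r) (h : p.1 = 0) : p.2 = 0 := by
  obtain ⟨h1, h2, h3⟩ := hp
  rw [h] at h3
  have : ‖p.2‖ ^ 2 = 0 := le_antisymm (by simpa using h3) (by positivity)
  simpa using this

lemma CC_move {r : ℝ} {u u₀ : ℝ} {z z₀ : ℂ} (hp : (u₀, z₀) ∈ CC r) (hu : 0 < u) (hlt : u < u₀)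
    (h : ‖z‖ ^ 2 * u₀ ≤ ‖z₀‖ ^ 2 * u) : (u, z) ∈ CC r := by
  obtain ⟨h1, h2, h3⟩ := hp
  simp only at h1 h2 h3
  refine ⟨hu.le, by simp only; linarith, ?_⟩
  simp only
  have h0 : 0 < u₀ := by linarith
  have : ‖z‖ ^ 2 * u₀ ≤ (r ^ 2 * u) * u₀ := by nlinarith
  exact le_of_mul_le_mul_right this h0

section core
variable {f W P : ℂ → ℂ} {α : ℝ} {m : ℂ} {r : ℝ}

lemma Q_analytic (hW : DifferentiableOn ℂ W (ball 0 1)) {p : ℂ × ℂ} (hp : p.2 ∈ ball (0 : ℂ) 1) :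
    AnalyticAt ℂ (QQ W) p := by
  have hWa : AnalyticAt ℂ W p.2 := hW.analyticAt (isOpen_ball.mem_nhds hp)
  have hWb : AnalyticAt ℂ (fun p : ℂ × ℂ => W p.2) p := hWa.comp_of_eq analyticAt_snd rfl
  exact analyticAt_fst.add ((analyticAt_const.sub analyticAt_fst).mul hWb)

lemma Q_ne (hW : DifferentiableOn ℂ W (ball 0 1)) (hW0 : 0 < (W 0).re)
    (hr1 : r < 1) (hr0 : 0 ≤ r)
    (R2 : ∀ z ∈ ball (0 : ℂ) 1, z * deriv W z = W z * (P z - m * W z))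
    (hD : ∀ u : ℝ, 0 < u → u ≤ 1 → ∀ z ∈ ball (0 : ℂ) 1, ‖z‖ ^ 2 ≤ u →
      ‖m * u + (1 - u) * P z - 1‖ < 1) :
    ∀ p ∈ CC r, QQ W ((p.1 : ℂ), p.2) ≠ 0 := by
  by_contra! hcon
  obtain ⟨p₁, hp₁, hp₁'⟩ := hcon
  have hcont : ContinuousOn (fun p : ℝ × ℂ => QQ W ((p.1 : ℂ), p.2)) (CC r) := by
    intro p hp
    have h1 := (Q_analytic hW (p := ((p.1 : ℂ), p.2)) (CC_ball hr1 hr0 hp)).continuousAt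
    exact (h1.comp_of_eq (f := fun p : ℝ × ℂ => ((p.1 : ℂ), p.2)) (by fun_prop) rfl).continuousWithinAt
  have hS : IsCompact (CC r ∩ (fun p : ℝ × ℂ => QQ W ((p.1 : ℂ), p.2)) ⁻¹' {0}) :=
    (CC_compact hr1 hr0).of_isClosed_subset
      (hcont.preimage_isClosed_of_isClosed (CC_compact hr1 hr0).isClosed isClosed_singleton)
      Set.inter_subset_left
  obtain ⟨⟨u₀, z₀⟩, ⟨hpC, hpQ⟩, hmin⟩ := hS.exists_isMinOn ⟨p₁, hp₁, hp₁'⟩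
    (f := Prod.fst) continuous_fst.continuousOn
  have hzb := CC_ball hr1 hr0 hpC
  have hle := CC_le hr1 hr0 hpC
  have hC := hpC
  obtain ⟨hu0, hu1, -⟩ := hpC
  simp only [QQ, Set.mem_preimage, Set.mem_singleton_iff] at hpQ hu0 hu1 hzb hle
  have hz : z₀ ≠ 0 := by
    rintro rfl
    have := congrArg Complex.re hpQ
    simp at this
    rcases hu1.lt_or_eq with h | h
    · nlinarith [mul_pos (sub_pos.mpr h) hW0]
    · subst h; simp at this
  have hu : 0 < u₀ := by
    rcases hu0.lt_or_eq with h | h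
    · exact h
    · exact absurd (CC_zero hC h.symm) hz
  have huc : (u₀ : ℂ) ≠ 0 := by exact_mod_cast hu.ne'
  have hu1' : (1 - u₀ : ℂ) ≠ 0 := by
    intro h
    rw [h] at hpQ
    simp at hpQ
    exact hu.ne' hpQ
  have hDD := hD u₀ hu hu1 z₀ hzb hle
  have hD0 : m * u₀ + (1 - u₀) * P z₀ ≠ 0 := by intro h; rw [h] at hDD; simp at hDD
  have hWd : HasDerivAt W (deriv W z₀) z₀ :=
    (hW.differentiableAt (isOpen_ball.mem_nhds hzb)).hasDerivAt
  have r2 := R2 z₀ hzb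
  have key : (1 - u₀) * (z₀ * ((1 - u₀) * deriv W z₀)) = -(u₀ * (m * u₀ + (1 - u₀) * P z₀)) := by
    linear_combination (1 - (u₀ : ℂ)) ^ 2 * r2 +
      ((1 - u₀) * P z₀ - m * ((1 - u₀) * W z₀ - u₀)) * hpQ
  have hB0 : (1 - u₀) * deriv W z₀ ≠ 0 := by
    intro h
    rw [h] at key
    simp only [mul_zero] at key
    exact (mul_ne_zero huc hD0) (neg_eq_zero.mp key.symm)
  have hmv := aux_move (K := QQ W) (u₀ := u₀) (z₀ := z₀) (A := 1 - W z₀)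
    (B := (1 - u₀) * deriv W z₀) (Q_analytic hW hzb)
    (by
      have := (hasDerivAt_id (u₀ : ℂ)).add (((hasDerivAt_id (u₀ : ℂ)).const_sub 1).mul_const (W z₀))
      exact this.congr_deriv (by ring))
    (by
      have := (hWd.const_mul (1 - (u₀ : ℂ))).const_add (u₀ : ℂ)
      exact this)
    hB0 hu hz hDD
    (by
      refine mul_left_cancel₀ hu1' ?_
      rw [key]
      linear_combination (u₀ * (m * u₀ + (1 - u₀) * P z₀)) * hpQ)
    Set.univ univ_mem
  obtain ⟨u, ⟨z, -, h1, h2⟩, h3, h4⟩ := (hmv.and ((eventually_mem_nhdsWithin).and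
    (nhdsWithin_le_nhds (lt_mem_nhds hu)))).exists
  have h3' : u < u₀ := h3
  have hmem : (u, z) ∈ CC r := CC_move hC h4 h3' h2
  have hle' : u₀ ≤ u := hmin (show (u, z) ∈ _ from ⟨hmem, by
    simp only [Set.mem_preimage, Set.mem_singleton_iff]; rw [h1]; simpa [QQ] using hpQ⟩)
  linarith

lemma Q_slit (hQ : ∀ p ∈ CC r, QQ W ((p.1 : ℂ), p.2) ≠ 0) :
    ∀ p ∈ CC r, QQ W ((p.1 : ℂ), p.2) ∈ Complex.slitPlane := by
  intro p hp
  by_contra h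
  rw [Complex.mem_slitPlane_iff, not_or, not_lt, not_not] at h
  obtain ⟨h1, h2⟩ := h
  set x : ℝ := -(QQ W ((p.1 : ℂ), p.2)).re with hx
  have hx0 : 0 ≤ x := by linarith
  have hq : QQ W ((p.1 : ℂ), p.2) = -(x : ℂ) := by
    apply Complex.ext <;> simp [hx, h2]
  obtain ⟨a, b, c⟩ := hp
  have hx1 : (1 + x : ℂ) ≠ 0 := by
    have : (1 + x : ℝ) ≠ 0 := by positivity
    exact_mod_cast this
  have hge : p.1 ≤ (p.1 + x) / (1 + x) := by
    rw [le_div_iff₀ (by positivity)]; nlinarith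
  refine hQ ((p.1 + x) / (1 + x), p.2) ⟨by positivity, ?_, ?_⟩ ?_
  · simp only; rw [div_le_one (by positivity)]; linarith
  · simp only
    exact c.trans (mul_le_mul_of_nonneg_left hge (sq_nonneg r))
  · simp only [QQ] at hq ⊢
    push_cast
    field_simp
    linear_combination hq

lemma F_analytic (hf : DifferentiableOn ℂ f (ball 0 1)) (hW : DifferentiableOn ℂ W (ball 0 1))
    (β : ℂ) {p : ℂ × ℂ} (hp : p.2 ∈ ball (0 : ℂ) 1) (hs : QQ W p ∈ Complex.slitPlane) :
    AnalyticAt ℂ (FF f W β) p := by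
  have hfa : AnalyticAt ℂ f p.2 := hf.analyticAt (isOpen_ball.mem_nhds hp)
  have hfb : AnalyticAt ℂ (fun p : ℂ × ℂ => f p.2) p := hfa.comp_of_eq analyticAt_snd rfl
  exact hfb.mul ((Q_analytic hW hp).cpow analyticAt_const hs)

lemma F_dz (hf : DifferentiableOn ℂ f (ball 0 1)) (hW : DifferentiableOn ℂ W (ball 0 1))
    (β : ℂ) {u z : ℂ} (hp : z ∈ ball (0 : ℂ) 1) (hs : QQ W (u, z) ∈ Complex.slitPlane) :
    HasDerivAt (fun z => FF f W β (u, z)) (deriv f z * (QQ W (u, z)) ^ β +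
      f z * (β * (QQ W (u, z)) ^ (β - 1) * ((1 - u) * deriv W z))) z := by
  have hWd : HasDerivAt W (deriv W z) z :=
    (hW.differentiableAt (isOpen_ball.mem_nhds hp)).hasDerivAt
  have hfd : HasDerivAt f (deriv f z) z :=
    (hf.differentiableAt (isOpen_ball.mem_nhds hp)).hasDerivAt
  have hQd : HasDerivAt (fun z => QQ W (u, z)) ((1 - u) * deriv W z) z :=
    (hWd.const_mul (1 - u)).const_add u
  exact hfd.mul (hQd.cpow_const hs)

lemma F_du (β : ℂ) {u z : ℂ} (hs : QQ W (u, z) ∈ Complex.slitPlane) :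
    HasDerivAt (fun u => FF f W β (u, z))
      (f z * (β * (QQ W (u, z)) ^ (β - 1) * (1 - W z))) u := by
  have hQd : HasDerivAt (fun u => QQ W (u, z)) (1 - W z) u := by
    have := (hasDerivAt_id u).add (((hasDerivAt_id u).const_sub 1).mul_const (W z))
    exact this.congr_deriv (by ring)
  exact (hQd.cpow_const hs).const_mul (f z)


lemma F_key (hα : 0 < α)
    (R1 : ∀ z ∈ ball (0 : ℂ) 1, z * deriv f z * α = m * W z * f z)
    (R2 : ∀ z ∈ ball (0 : ℂ) 1, z * deriv W z = W z * (P z - m * W z))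
    {u z : ℂ} (hz : z ∈ ball (0 : ℂ) 1) (hX : QQ W (u, z) ≠ 0) :
    z * (deriv f z * (QQ W (u, z)) ^ (1 / α : ℂ) +
      f z * ((1 / α : ℂ) * (QQ W (u, z)) ^ ((1 / α : ℂ) - 1) * ((1 - u) * deriv W z))) =
    f z * (QQ W (u, z)) ^ (1 / α : ℂ) * W z * (m * u + (1 - u) * P z) / (α * QQ W (u, z)) := by
  have hαc : (α : ℂ) ≠ 0 := by exact_mod_cast hα.ne'
  rw [Complex.cpow_sub _ _ hX, Complex.cpow_one]
  generalize hY : (QQ W (u, z)) ^ (1 / α : ℂ) = Y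
  have hXe : QQ W (u, z) = u + (1 - u) * W z := rfl
  have r1 := R1 z hz
  have r2 := R2 z hz
  generalize QQ W (u, z) = X at *
  field_simp
  linear_combination Y * X * r1 + Y * f z * (1 - u) * r2 + Y * f z * m * W z * hXe

lemma F_dz_ne (hα : 0 < α) (hf0 : f 0 = 0) (hf'0 : deriv f 0 ≠ 0)
    (hfne : ∀ z ∈ ball (0 : ℂ) 1, z ≠ 0 → f z ≠ 0)
    (hWne : ∀ z ∈ ball (0 : ℂ) 1, W z ≠ 0)
    (hr1 : r < 1) (hr0 : 0 ≤ r)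
    (R1 : ∀ z ∈ ball (0 : ℂ) 1, z * deriv f z * α = m * W z * f z)
    (R2 : ∀ z ∈ ball (0 : ℂ) 1, z * deriv W z = W z * (P z - m * W z))
    (hD : ∀ u : ℝ, 0 < u → u ≤ 1 → ∀ z ∈ ball (0 : ℂ) 1, ‖z‖ ^ 2 ≤ u →
      ‖m * u + (1 - u) * P z - 1‖ < 1)
    {u : ℝ} {z : ℂ} (hp : (u, z) ∈ CC r) (hX : QQ W ((u : ℂ), z) ≠ 0) :
    (deriv f z * (QQ W (u, z)) ^ (1 / α : ℂ) +
      f z * ((1 / α : ℂ) * (QQ W (u, z)) ^ ((1 / α : ℂ) - 1) * ((1 - u) * deriv W z))) ≠ 0 := by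
  have hαc : (α : ℂ) ≠ 0 := by exact_mod_cast hα.ne'
  have hzb : z ∈ ball (0 : ℂ) 1 := CC_ball hr1 hr0 hp
  by_cases hz : z = 0
  · subst hz
    rw [hf0]
    simp only [zero_mul, add_zero]
    exact mul_ne_zero hf'0 (by simp [Complex.cpow_eq_zero_iff, hX])
  · have hu : 0 < u := by
      rcases hp.1.lt_or_eq with h | h
      · exact h
      · exact absurd (CC_zero hp h.symm) hz
    have hDD := hD u hu hp.2.1 z hzb (CC_le hr1 hr0 hp)
    have hD0 : m * u + (1 - u) * P z ≠ 0 := by intro h; rw [h] at hDD; simp at hDD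
    intro h
    have hk := F_key hα R1 R2 hzb hX
    rw [h, mul_zero] at hk
    refine absurd hk.symm ?_
    refine div_ne_zero (mul_ne_zero (mul_ne_zero (mul_ne_zero (hfne z hzb hz) ?_) (hWne z hzb)) hD0)
      (mul_ne_zero hαc hX)
    simp [Complex.cpow_eq_zero_iff, hX]

lemma F_move (hα : 0 < α) (hf : DifferentiableOn ℂ f (ball 0 1))
    (hW : DifferentiableOn ℂ W (ball 0 1)) (hf0 : f 0 = 0) (hf'0 : deriv f 0 ≠ 0)
    (hfne : ∀ z ∈ ball (0 : ℂ) 1, z ≠ 0 → f z ≠ 0)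
    (hWne : ∀ z ∈ ball (0 : ℂ) 1, W z ≠ 0)
    (hr1 : r < 1) (hr0 : 0 ≤ r)
    (R1 : ∀ z ∈ ball (0 : ℂ) 1, z * deriv f z * α = m * W z * f z)
    (R2 : ∀ z ∈ ball (0 : ℂ) 1, z * deriv W z = W z * (P z - m * W z))
    (hD : ∀ u : ℝ, 0 < u → u ≤ 1 → ∀ z ∈ ball (0 : ℂ) 1, ‖z‖ ^ 2 ≤ u →
      ‖m * u + (1 - u) * P z - 1‖ < 1)
    {u₀ : ℝ} {z₀ : ℂ} (hp : (u₀, z₀) ∈ CC r) (hu : 0 < u₀)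
    (hs : QQ W ((u₀ : ℂ), z₀) ∈ Complex.slitPlane) (V : Set ℂ) (hV : V ∈ 𝓝 z₀) :
    ∀ᶠ u : ℝ in 𝓝[<] u₀, ∃ z ∈ V, (u, z) ∈ CC r ∧
      FF f W (1 / α) ((u : ℂ), z) = FF f W (1 / α) ((u₀ : ℂ), z₀) * (u / u₀ : ℂ) ^ (1 / α : ℂ) := by
  have hαc : (α : ℂ) ≠ 0 := by exact_mod_cast hα.ne'
  have huc : (u₀ : ℂ) ≠ 0 := by exact_mod_cast hu.ne'
  have hX : QQ W ((u₀ : ℂ), z₀) ≠ 0 := Complex.slitPlane_ne_zero hs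
  have hzb : z₀ ∈ ball (0 : ℂ) 1 := CC_ball hr1 hr0 hp
  have hev : ∀ᶠ u : ℝ in 𝓝[<] u₀, u < u₀ ∧ 0 < u :=
    (eventually_mem_nhdsWithin).and (nhdsWithin_le_nhds (lt_mem_nhds hu))
  by_cases hz : z₀ = 0
  · subst hz
    filter_upwards [hev] with u hu'
    refine ⟨0, mem_of_mem_nhds hV, CC_move hp hu'.2 hu'.1 (by simp), ?_⟩
    simp [FF, hf0]
  have hB0 := F_dz_ne hα hf0 hf'0 hfne hWne hr1 hr0 R1 R2 hD hp hX
  have hk := F_key (u := u₀) hα R1 R2 hzb hX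
  have hFa := F_analytic hf hW (1 / α : ℂ) (p := ((u₀ : ℂ), z₀)) hzb hs
  have hdz := F_dz hf hW (1 / α : ℂ) hzb hs
  have hdu := F_du (f := f) (1 / α : ℂ) hs
  set a := FF f W (1 / α) ((u₀ : ℂ), z₀) with ha
  have h1s : (u₀ / u₀ : ℂ) ∈ Complex.slitPlane := by rw [div_self huc]; exact Complex.one_mem_slitPlane
  have hLa : AnalyticAt ℂ (fun p : ℂ × ℂ => a * (p.1 / u₀) ^ (1 / α : ℂ)) ((u₀ : ℂ), z₀) := by
    refine analyticAt_const.mul (AnalyticAt.cpow ?_ analyticAt_const h1s)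
    exact analyticAt_fst.div analyticAt_const huc
  have hLd : HasDerivAt (fun u : ℂ => a * (u / u₀) ^ (1 / α : ℂ)) (a * (1 / (α * u₀))) u₀ := by
    have := (((hasDerivAt_id (u₀ : ℂ)).div_const (u₀ : ℂ)).cpow_const (c := (1 / α : ℂ)) h1s).const_mul a
    refine this.congr_deriv ?_
    simp only [id]
    rw [div_self huc, Complex.one_cpow]
    field_simp
  have hmv := aux_move (K := fun p => FF f W (1 / α) p - a * (p.1 / u₀) ^ (1 / α : ℂ))
    (u₀ := u₀) (z₀ := z₀) (hFa.sub hLa) (hdu.sub hLd) (hdz.sub_const (a * ((u₀ : ℂ) / u₀) ^ (1 / α : ℂ))) hB0 hu hz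
    (hD u₀ hu hp.2.1 z₀ hzb (CC_le hr1 hr0 hp))
    (by
      rw [hk, ha, Complex.cpow_sub _ _ hX, Complex.cpow_one]
      simp only [FF]
      have hXe : QQ W ((u₀ : ℂ), z₀) = u₀ + (1 - u₀) * W z₀ := rfl
      generalize hY : (QQ W ((u₀ : ℂ), z₀)) ^ (1 / α : ℂ) = Y
      generalize QQ W ((u₀ : ℂ), z₀) = X at *
      field_simp
      rw [hXe]
      ring) V hV
  filter_upwards [hmv, hev] with u ⟨z, h1, h2, h3⟩ hu'
  refine ⟨z, h1, CC_move hp hu'.2 hu'.1 h3, ?_⟩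
  simp only [div_self huc, Complex.one_cpow] at h2
  rw [← ha] at h2
  linear_combination h2

theorem core_inj (hα : 0 < α) (hf : DifferentiableOn ℂ f (ball 0 1))
    (hW : DifferentiableOn ℂ W (ball 0 1)) (hf0 : f 0 = 0) (hf'0 : deriv f 0 ≠ 0)
    (hfne : ∀ z ∈ ball (0 : ℂ) 1, z ≠ 0 → f z ≠ 0)
    (hWne : ∀ z ∈ ball (0 : ℂ) 1, W z ≠ 0) (hW0 : 0 < (W 0).re)
    (R1 : ∀ z ∈ ball (0 : ℂ) 1, z * deriv f z * α = m * W z * f z)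
    (R2 : ∀ z ∈ ball (0 : ℂ) 1, z * deriv W z = W z * (P z - m * W z))
    (hD : ∀ u : ℝ, 0 < u → u ≤ 1 → ∀ z ∈ ball (0 : ℂ) 1, ‖z‖ ^ 2 ≤ u →
      ‖m * u + (1 - u) * P z - 1‖ < 1) :
    Set.InjOn f (ball (0 : ℂ) 1) := by
  intro x₁ hx₁ x₂ hx₂ hx
  by_contra hne
  set r := max ‖x₁‖ ‖x₂‖ with hr
  have hr0 : 0 ≤ r := (norm_nonneg x₁).trans (le_max_left _ _)
  have hr1 : r < 1 := max_lt (by simpa using hx₁) (by simpa using hx₂)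
  have hs := Q_slit (Q_ne hW hW0 hr1 hr0 R2 hD)
  let E : Set (ℝ × ℂ × ℂ) := {t | ((t.1, t.2.1) ∈ CC r ∧ (t.1, t.2.2) ∈ CC r) ∧
    FF f W (1 / α) ((t.1 : ℂ), t.2.1) = FF f W (1 / α) ((t.1 : ℂ), t.2.2)}
  let S : Set (ℝ × ℂ × ℂ) := {t | t ∈ E ∧ t.2.1 ≠ t.2.2}
  have hFc : ContinuousOn (fun p : ℝ × ℂ => FF f W (1 / α) ((p.1 : ℂ), p.2)) (CC r) := by
    intro p hp
    have h1 := (F_analytic hf hW (1 / α) (p := ((p.1 : ℂ), p.2)) (CC_ball hr1 hr0 hp)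
      (hs p hp)).continuousAt
    exact (h1.comp_of_eq (f := fun p : ℝ × ℂ => ((p.1 : ℂ), p.2)) (by fun_prop) rfl).continuousWithinAt
  have hCcl := (CC_compact hr1 hr0).isClosed
  have hEcl : IsClosed E := by
    have hc : IsClosed {t : ℝ × ℂ × ℂ | (t.1, t.2.1) ∈ CC r ∧ (t.1, t.2.2) ∈ CC r} :=
      (hCcl.preimage (f := fun t : ℝ × ℂ × ℂ => (t.1, t.2.1)) (by fun_prop)).inter
        (hCcl.preimage (f := fun t : ℝ × ℂ × ℂ => (t.1, t.2.2)) (by fun_prop))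
    have h1 : ContinuousOn (fun t : ℝ × ℂ × ℂ => FF f W (1 / α) ((t.1 : ℂ), t.2.1) -
        FF f W (1 / α) ((t.1 : ℂ), t.2.2))
        {t : ℝ × ℂ × ℂ | (t.1, t.2.1) ∈ CC r ∧ (t.1, t.2.2) ∈ CC r} := by
      refine ContinuousOn.sub ?_ ?_
      · exact hFc.comp (f := fun t : ℝ × ℂ × ℂ => (t.1, t.2.1)) (by fun_prop) (fun t ht => ht.1)
      · exact hFc.comp (f := fun t : ℝ × ℂ × ℂ => (t.1, t.2.2)) (by fun_prop) (fun t ht => ht.2)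
    have h2 := h1.preimage_isClosed_of_isClosed hc (isClosed_singleton (x := (0 : ℂ)))
    convert h2 using 1
    ext t
    simp [E, sub_eq_zero]
  have hScl : IsClosed S := by
    rw [← isOpen_compl_iff, isOpen_iff_mem_nhds]
    intro t ht
    by_cases hE : t ∈ E
    · have heq : t.2.1 = t.2.2 := by
        by_contra h; exact ht ⟨hE, h⟩
      have hC := hE.1.1
      have hb := CC_ball hr1 hr0 hC
      have hsl := hs _ hC
      have hi := aux_inj (K := FF f W (1 / α)) (p := ((t.1 : ℂ), t.2.1))
        (F_analytic hf hW (1 / α) hb hsl) (F_dz hf hW (1 / α) hb hsl)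
        (F_dz_ne hα hf0 hf'0 hfne hWne hr1 hr0 R1 R2 hD hC (Complex.slitPlane_ne_zero hsl))
      have ht : Tendsto (fun s : ℝ × ℂ × ℂ => (((s.1 : ℂ), s.2.1), ((s.1 : ℂ), s.2.2))) (𝓝 t)
          (𝓝 (((t.1 : ℂ), t.2.1), ((t.1 : ℂ), t.2.1))) := by
        nth_rewrite 2 [heq]
        exact Continuous.tendsto
          (f := fun s : ℝ × ℂ × ℂ => (((s.1 : ℂ), s.2.1), ((s.1 : ℂ), s.2.2))) (by fun_prop) t
      filter_upwards [ht.eventually hi] with s h1 h2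
      exact h2.2 (h1 rfl h2.1.2)
    · filter_upwards [hEcl.isOpen_compl.mem_nhds hE] with s h1 h2
      exact h1 h2.1
  have hSc : IsCompact S := by
    refine IsCompact.of_isClosed_subset ((isCompact_Icc (a := (0 : ℝ)) (b := 1)).prod
      ((isCompact_closedBall (0 : ℂ) 1).prod (isCompact_closedBall (0 : ℂ) 1))) hScl ?_
    intro t ht
    exact ⟨⟨ht.1.1.1.1, ht.1.1.1.2.1⟩, ball_subset_closedBall (CC_ball hr1 hr0 ht.1.1.1),
      ball_subset_closedBall (CC_ball hr1 hr0 ht.1.1.2)⟩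
  have hSne : (1, x₁, x₂) ∈ S := by
    refine ⟨⟨⟨⟨zero_le_one, le_rfl, ?_⟩, ⟨zero_le_one, le_rfl, ?_⟩⟩, ?_⟩, hne⟩
    · simp only [mul_one]; exact pow_le_pow_left₀ (norm_nonneg _) (le_max_left _ _) 2
    · simp only [mul_one]; exact pow_le_pow_left₀ (norm_nonneg _) (le_max_right _ _) 2
    · simp [FF, QQ, hx]
  obtain ⟨⟨u₀, z₁, z₂⟩, ⟨⟨⟨hC1, hC2⟩, hFe⟩, hz⟩, hmin⟩ := hSc.exists_isMinOn ⟨_, hSne⟩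
    (f := Prod.fst) continuous_fst.continuousOn
  simp only at hC1 hC2 hFe hz
  have hu : 0 < u₀ := by
    rcases hC1.1.lt_or_eq with h | h
    · exact h
    · exact absurd ((CC_zero hC1 h.symm).trans (CC_zero hC2 h.symm).symm) hz
  obtain ⟨V₁, V₂, hV₁, hV₂, hm₁, hm₂, hdis⟩ := t2_separation hz
  have h1 := F_move hα hf hW hf0 hf'0 hfne hWne hr1 hr0 R1 R2 hD hC1 hu (hs _ hC1) V₁
    (hV₁.mem_nhds hm₁)
  have h2 := F_move hα hf hW hf0 hf'0 hfne hWne hr1 hr0 R1 R2 hD hC2 hu (hs _ hC2) V₂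
    (hV₂.mem_nhds hm₂)
  obtain ⟨u, ⟨⟨w₁, a1, a2, a3⟩, w₂, b1, b2, b3⟩, hlt⟩ :=
    ((h1.and h2).and eventually_mem_nhdsWithin).exists
  have hlt' : u < u₀ := hlt
  have : u₀ ≤ u := hmin (show (u, w₁, w₂) ∈ S from
    ⟨⟨⟨a2, b2⟩, by simp only; rw [a3, b3, hFe]⟩, fun h => by
      simp only at h
      exact Set.disjoint_left.mp hdis a1 (h ▸ b1)⟩)
  linarith

end core

lemma disc_bound {α u c : ℝ} {E ω P : ℂ} (hα : 0 < α) (hα1 : α ≤ 1) (hu1 : u ≤ 1)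
    (hc : ‖1 + E ^ 2‖ = 2 * c) (hc2 : c < 1 / 2) (hω : ‖ω‖ ^ 2 ≤ u) (hω1 : ‖ω‖ < 1)
    (hP : P * (1 - ω) = α * (1 + ω * E ^ 2)) :
    ‖-α * E ^ 2 * u + (1 - u) * P - 1‖ < 1 := by
  have hne : 1 - ω ≠ 0 := by
    intro h
    rw [← sub_eq_zero.mp h] at hω1
    simp at hω1
  have hpos : 0 < ‖1 - ω‖ := norm_pos_iff.mpr hne
  have hc0 : 0 ≤ c := by have := norm_nonneg (1 + E ^ 2); linarith
  have e : (1 - ω) * (-α * E ^ 2 * u + (1 - u) * P - 1) =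
      (1 - ω) * ((α - 1 : ℝ) : ℂ) + (α : ℂ) * (1 + E ^ 2) * (ω - u) := by
    push_cast
    linear_combination (1 - (u : ℂ)) * hP
  have h1 : ‖ω - u‖ ≤ ‖1 - ω‖ := by
    refine (pow_le_pow_iff_left₀ (norm_nonneg _) (norm_nonneg _) two_ne_zero).mp ?_
    rw [← Complex.normSq_eq_norm_sq, ← Complex.normSq_eq_norm_sq]
    rw [← Complex.normSq_eq_norm_sq] at hω
    have hu0 : 0 ≤ u := (Complex.normSq_nonneg ω).trans hω
    have h3 := Complex.normSq_nonneg (1 - ω)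
    simp [Complex.normSq_apply] at hω h3 ⊢
    nlinarith [mul_nonneg (sub_nonneg.mpr hω) (sub_nonneg.mpr hu1), mul_nonneg (sub_nonneg.mpr hu1) h3]
  have h2 : ‖1 - ω‖ * ‖-α * E ^ 2 * u + (1 - u) * P - 1‖ ≤
      ‖1 - ω‖ * (1 - α) + α * (2 * c) * ‖ω - u‖ := by
    rw [← norm_mul, e]
    refine (norm_add_le _ _).trans ?_
    rw [norm_mul, norm_mul, norm_mul, hc, Complex.norm_real, Complex.norm_real, Real.norm_eq_abs,
      Real.norm_eq_abs, abs_of_pos hα, abs_of_nonpos (by linarith)]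
    linarith
  have h3 : α * (2 * c) * ‖ω - u‖ ≤ α * (2 * c) * ‖1 - ω‖ :=
    mul_le_mul_of_nonneg_left h1 (by positivity)
  have h4 : α * (2 * c) * ‖1 - ω‖ < α * ‖1 - ω‖ := by
    refine mul_lt_mul_of_pos_right ?_ hpos
    nlinarith
  by_contra hcon
  push Not at hcon
  nlinarith

theorem univalence_q_nonpos (lam : ℝ)
    (hlam : lam ∈ Set.Ioo (-(Real.pi / 2)) (Real.pi / 2))
    (hcos : 0 < Real.cos lam) (hcos2 : Real.cos lam < 1 / 2)
    (q : ℝ) (hq : q ∈ Set.Ioc (-1 : ℝ) 0)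
    (f : ℂ → ℂ)
    (hf : DifferentiableOn ℂ f (ball (0 : ℂ) 1))
    (hf0 : f 0 = 0) (hf'0 : deriv f 0 = 1)
    (hf' : ∀ z ∈ ball (0 : ℂ) 1, deriv f z ≠ 0)
    (hfne : ∀ z ∈ ball (0 : ℂ) 1, z ≠ 0 → f z ≠ 0)
    (hcond : ∀ z ∈ ball (0 : ℂ) 1,
      0 < (Complex.exp (-(lam : ℂ) * Complex.I) *
        (1 + z * deriv (deriv f) z / deriv f z +
          (q : ℂ) * (if z = 0 then 1 else z * deriv f z / f z))).re) :
    Set.InjOn f (ball (0 : ℂ) 1) := by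
  obtain ⟨hq1, hq0⟩ := hq
  have h0b : (0 : ℂ) ∈ ball (0 : ℂ) 1 := by simp
  have hα : 0 < 1 + q := by linarith
  have hα1 : 1 + q ≤ 1 := by linarith
  set α : ℝ := 1 + q with hαdef
  have hαc : (α : ℂ) = 1 + q := by rw [hαdef]; push_cast; ring
  set E : ℂ := Complex.exp (lam * Complex.I) with hE
  set e : ℂ := Complex.exp (-(lam : ℂ) * Complex.I) with he
  have heE : e * E = 1 := by
    rw [he, hE, ← Complex.exp_add]; simp
  have hEre : E.re = Real.cos lam := by rw [hE, Complex.exp_ofReal_mul_I_re]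
  have hEim : E.im = Real.sin lam := by rw [hE, Complex.exp_ofReal_mul_I_im]
  have here : e.re = Real.cos lam := by
    rw [he, ← Complex.ofReal_neg, Complex.exp_ofReal_mul_I_re, Real.cos_neg]
  have heim : e.im = -Real.sin lam := by
    rw [he, ← Complex.ofReal_neg, Complex.exp_ofReal_mul_I_im, Real.sin_neg]
  have hsc := Real.sin_sq_add_cos_sq lam
  have hEn : ‖E‖ = 1 := by rw [hE, Complex.norm_exp_ofReal_mul_I]
  have hen : ‖e‖ = 1 := by rw [he, ← Complex.ofReal_neg, Complex.norm_exp_ofReal_mul_I]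
  have he0 : e ≠ 0 := Complex.exp_ne_zero _
  have hEe2 : e + E = 2 * (Real.cos lam : ℂ) := by
    apply Complex.ext
    · simp only [Complex.add_re, here, hEre]; rw [← Complex.ofReal_ofNat, ← Complex.ofReal_mul, Complex.ofReal_re]; ring
    · simp only [Complex.add_im, heim, hEim]; rw [← Complex.ofReal_ofNat, ← Complex.ofReal_mul, Complex.ofReal_im]; ring
  have hc : ‖1 + E ^ 2‖ = 2 * Real.cos lam := by
    have : 1 + E ^ 2 = E * (2 * (Real.cos lam : ℂ)) := by
      rw [← hEe2]; linear_combination -heE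
    rw [this, norm_mul, hEn, norm_mul, Complex.norm_real, Real.norm_eq_abs, abs_of_pos hcos]
    simp
  -- the auxiliary functions
  set g := dslope f 0 with hg
  have hfg : ∀ z, f z = z * g z := by
    intro z
    have := sub_smul_dslope f 0 z
    simp only [sub_zero, hf0, smul_eq_mul] at this
    exact this.symm
  have hgd : DifferentiableOn ℂ g (ball 0 1) :=
    (Complex.differentiableOn_dslope (isOpen_ball.mem_nhds h0b)).mpr hf
  have hg0 : g 0 = 1 := by rw [hg, dslope_same, hf'0]
  have hgne : ∀ z ∈ ball (0 : ℂ) 1, g z ≠ 0 := by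
    intro z hz h
    by_cases h0 : z = 0
    · rw [h0, hg0] at h; exact one_ne_zero h
    · exact hfne z hz h0 (by rw [hfg, h, mul_zero])
  have hf1 : DifferentiableOn ℂ (deriv f) (ball 0 1) := hf.deriv isOpen_ball
  have hf2 : DifferentiableOn ℂ (deriv (deriv f)) (ball 0 1) := hf1.deriv isOpen_ball
  let W : ℂ → ℂ := fun z => -e ^ 2 * (deriv f z / g z)
  let P : ℂ → ℂ := fun z => 1 + z * deriv (deriv f) z / deriv f z + q * (deriv f z / g z)
  have hWd : DifferentiableOn ℂ W (ball 0 1) := (hf1.div hgd hgne).const_mul _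
  have hPd : DifferentiableOn ℂ P (ball 0 1) :=
    (((differentiableOn_id.mul hf2).div hf1 hf').const_add 1).add ((hf1.div hgd hgne).const_mul _)
  have hP0 : P 0 = α := by simp [P, hg0, hf'0, hαc]
  have hPre : ∀ z ∈ ball (0 : ℂ) 1, 0 < (e * P z).re := by
    intro z hz
    have h := hcond z hz
    have e1 : (if z = 0 then 1 else z * deriv f z / f z) = deriv f z / g z := by
      split_ifs with h0
      · rw [h0, hf'0, hg0]; simp
      · rw [hfg z, mul_div_mul_left _ _ h0]
    rw [e1] at h
    exact h
  have hden : ∀ z ∈ ball (0 : ℂ) 1, P z + α * E ^ 2 ≠ 0 := by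
    intro z hz h
    have h1 : e * P z + α * E = 0 := by
      linear_combination e * h - α * E * heE
    have h2 := congrArg Complex.re h1
    have h3 := hPre z hz
    rw [Complex.add_re, Complex.re_ofReal_mul, hEre, Complex.zero_re] at h2
    nlinarith [mul_pos hα hcos]
  let ω : ℂ → ℂ := fun z => (P z - α) / (P z + α * E ^ 2)
  have hωd : DifferentiableOn ℂ ω (ball 0 1) := (hPd.sub_const _).div (hPd.add_const _) hden
  have hω0 : ω 0 = 0 := by simp [ω, hP0]
  have hωb : Set.MapsTo ω (ball 0 1) (closedBall 0 1) := by
    intro z hz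
    simp only [mem_closedBall, dist_zero_right, ω]
    rw [norm_div, div_le_one (norm_pos_iff.mpr (hden z hz))]
    have a1 : ‖P z - α‖ = ‖e * P z - α * e‖ := by
      rw [show e * P z - α * e = e * (P z - α) by ring, norm_mul, hen, one_mul]
    have a2 : ‖P z + α * E ^ 2‖ = ‖e * P z + α * E‖ := by
      rw [show e * P z + α * E = e * (P z + α * E ^ 2) by linear_combination -α * E * heE,
        norm_mul, hen, one_mul]
    rw [a1, a2]
    refine (pow_le_pow_iff_left₀ (norm_nonneg _) (norm_nonneg _) two_ne_zero).mp ?_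
    rw [← Complex.normSq_eq_norm_sq, ← Complex.normSq_eq_norm_sq]
    have h3 := hPre z hz
    generalize e * P z = X at h3
    simp only [Complex.normSq_apply, Complex.add_re, Complex.add_im, Complex.sub_re, Complex.sub_im,
      Complex.re_ofReal_mul, Complex.im_ofReal_mul, hEre, hEim, here, heim]
    nlinarith [mul_pos (mul_pos hα hcos) h3]
  refine core_inj (W := W) (P := P) (α := α) (m := -α * E ^ 2) hα hf hWd hf0
    (by rw [hf'0]; exact one_ne_zero) hfne ?_ ?_ ?_ ?_ ?_
  · intro z hz
    exact mul_ne_zero (neg_ne_zero.mpr (pow_ne_zero 2 he0)) (div_ne_zero (hf' z hz) (hgne z hz))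
  · have : W 0 = -e ^ 2 := by simp [W, hf'0, hg0]
    rw [this, pow_two, Complex.neg_re, Complex.mul_re, here, heim]
    nlinarith
  · intro z hz
    have hgz := hgne z hz
    simp only [W]
    rw [hfg z]
    have : E ^ 2 * e ^ 2 = 1 := by rw [← mul_pow, mul_comm, heE, one_pow]
    field_simp
    linear_combination (-(z * deriv f z * α)) * this
  · intro z hz
    have hgz := hgne z hz
    have hfz := hf' z hz
    have hnb := isOpen_ball.mem_nhds hz
    have d1 : HasDerivAt g (deriv g z) z := (hgd.differentiableAt hnb).hasDerivAt
    have d2 : HasDerivAt (deriv f) (deriv (deriv f) z) z := (hf1.differentiableAt hnb).hasDerivAt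
    have d3 : deriv f z = g z + z * deriv g z := by
      have h1 : HasDerivAt (fun z => z * g z) (1 * g z + z * deriv g z) z :=
        (hasDerivAt_id z).mul d1
      have h2 : f = fun z => z * g z := funext hfg
      have h3 : deriv f z = 1 * g z + z * deriv g z := by
        conv_lhs => rw [h2]
        exact h1.deriv
      rw [h3, one_mul]
    have d4 : deriv W z = -e ^ 2 * ((deriv (deriv f) z * g z - deriv f z * deriv g z) / g z ^ 2) :=
      ((d2.div d1 hgz).const_mul (-e ^ 2)).deriv
    rw [d4]
    have hee : E ^ 2 * e ^ 2 = 1 := by rw [← mul_pow, mul_comm, heE, one_pow]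
    have hmW : -α * E ^ 2 * W z = α * (deriv f z / g z) := by
      simp only [W]
      linear_combination α * (deriv f z / g z) * hee
    rw [hmW]
    simp only [W, P]
    rw [hαc]
    generalize deriv (deriv f) z = f2 at *
    generalize deriv f z = f1 at *
    generalize deriv g z = g1 at *
    generalize g z = g0 at *
    field_simp
    linear_combination (-f1) * d3
  · intro u hu hu1 z hz hzu
    have hωz : ‖ω z‖ ≤ ‖z‖ :=
      Complex.norm_le_norm_of_mapsTo_ball hωd hωb hω0 (by simpa using hz)
    have hz1 : ‖z‖ < 1 := by simpa using hz
    refine disc_bound hα hα1 hu1 hc hcos2 (ω := ω z)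
      ((pow_le_pow_left₀ (norm_nonneg _) hωz 2).trans hzu) (hωz.trans_lt hz1) ?_
    have := hden z hz
    simp only [ω]
    field_simp
    ring
end

section
/- Let λ ∈ (−π/2, π/2), let q > 0, and assume 0 < cos λ < 1/(2 + 4q). Let f be analytic on the unit disk 𝔻 with f(0) = 0, f'(0) = 1, f'(z) ≠ 0 on 𝔻 and f(z) ≠ 0 for z ≠ 0. If Re(e^{−iλ}(1 + z f''(z)/f'(z) + q · z f'(z)/f(z))) > 0 for all z ∈ 𝔻 (where z f'(z)/f(z) is interpreted as 1 at z = 0), then f is univalent (injective) on 𝔻. -/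
open Metric Filter Topology

theorem ev_ne {α : Type*} {l : Filter α} {f g : α → ℂ} {a b : ℂ} (hf : Tendsto f l (𝓝 a))
    (hg : Tendsto g l (𝓝 b)) (hab : a ≠ b) : ∀ᶠ x in l, f x ≠ g x := by
  by_contra h
  exact hab (tendsto_nhds_unique_of_frequently_eq hf hg ((not_eventually.mp h).mono fun x hx => not_not.mp hx))

theorem slide (Θ : ℂ × ℂ → ℂ) (r t0 : ℝ) (z : ℂ) (L : ℂ × ℂ →L[ℂ] ℂ)
    (h : HasStrictFDerivAt Θ L ((t0 : ℂ), z)) (hc : L (0, 1) ≠ 0) (hr : 0 < r)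
    (hz : ‖z‖ ≤ r * Real.exp (-t0))
    (hb : ‖z‖ = r * Real.exp (-t0) → 1 < (L (1, 0) / (z * L (0, 1))).re) :
    ∃ φ : ℝ → ℂ, Tendsto φ (𝓝[>] t0) (𝓝 z) ∧
      ∀ᶠ t : ℝ in 𝓝[>] t0, Θ ((t : ℂ), φ t) = Θ ((t0 : ℂ), z) ∧ ‖φ t‖ ≤ r * Real.exp (-t) := by
  have hL : ∀ x : ℂ, L (0, x) = L (0, 1) * x := by
    intro x
    have : ((0 : ℂ), x) = x • ((0 : ℂ), (1 : ℂ)) := by simp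
    rw [this, map_smul, smul_eq_mul, mul_comm]
  have hinv : (L ∘L .inr ℂ ℂ ℂ).IsInvertible := by
    refine ⟨ContinuousLinearEquiv.unitsEquivAut ℂ (Units.mk0 _ hc), ?_⟩
    ext
    simp
  set ψ := h.implicitFunctionOfProdDomain hinv with hψ
  have h1 : Tendsto ψ (𝓝 (t0 : ℂ)) (𝓝 z) := h.tendsto_implicitFunctionOfProdDomain hinv
  have h2 : ∀ᶠ x in 𝓝 (t0 : ℂ), Θ (x, ψ x) = Θ ((t0 : ℂ), z) :=
    h.eventually_apply_implicitFunctionOfProdDomain hinv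
  have h3 := h.hasStrictFDerivAt_implicitFunctionOfProdDomain hinv
  rw [← hψ] at h3
  have hψ0 : ψ (t0 : ℂ) = z :=
    (h.eventually_apply_eq_iff_implicitFunctionOfProdDomain hinv).self_of_nhds.mp rfl
  set d : ℂ := (-(L ∘L .inr ℂ ℂ ℂ).inverse ∘L (L ∘L .inl ℂ ℂ ℂ)) 1 with hd
  have hdval : L (0, 1) * d = - L (1, 0) := by
    have h5 : (L ∘L .inr ℂ ℂ ℂ) ((L ∘L .inr ℂ ℂ ℂ).inverse (L (1, 0))) = L (1, 0) := by
      have := hinv.self_comp_inverse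
      exact congrArg (fun M : ℂ →L[ℂ] ℂ => M (L (1, 0))) this
    have h6 : d = - (L ∘L .inr ℂ ℂ ℂ).inverse (L (1, 0)) := by
      simp [hd]
    rw [h6, mul_neg, ← hL]
    simpa using h5
  have hder : HasDerivAt ψ d (t0 : ℂ) := h3.hasFDerivAt.hasDerivAt
  have hder' : HasDerivAt (fun t : ℝ => ψ (t : ℂ)) d t0 := hder.comp_ofReal
  have hcont : Tendsto (fun t : ℝ => (t : ℂ)) (𝓝[>] t0) (𝓝 (t0 : ℂ)) :=
    (Complex.continuous_ofReal.tendsto t0).mono_left nhdsWithin_le_nhds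
  refine ⟨fun t => ψ (t : ℂ), h1.comp hcont, ?_⟩
  refine (hcont.eventually h2).and ?_
  rcases hz.lt_or_eq with hlt | heq
  · have e1 : Tendsto (fun t : ℝ => ‖ψ (t : ℂ)‖ - r * Real.exp (-t)) (𝓝[>] t0)
        (𝓝 (‖z‖ - r * Real.exp (-t0))) := by
      refine ((h1.comp hcont).norm).sub ?_
      refine Tendsto.mono_left ?_ nhdsWithin_le_nhds
      exact (by fun_prop : Continuous fun t : ℝ => r * Real.exp (-t)).tendsto t0
    filter_upwards [e1.eventually (gt_mem_nhds (by linarith : ‖z‖ - r * Real.exp (-t0) < 0))] with t ht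
    linarith
  · have hb := hb heq
    have hzpos : 0 < ‖z‖ := by rw [heq]; positivity
    have hz0 : z ≠ 0 := norm_pos_iff.mp hzpos
    have hdz : d = - (L (1, 0) / (z * L (0, 1))) * z := by
      field_simp
      rw [mul_comm, hdval]
    -- derivative of e^t ψ
    set m : ℝ → ℝ := fun t => Complex.normSq (ψ (t : ℂ)) * Real.exp (2 * t) with hm
    have hre : HasDerivAt (fun t : ℝ => (ψ (t : ℂ)).re) d.re t0 := by
      exact (Complex.reCLM.hasFDerivAt.comp_hasDerivAt t0 hder')
    have him : HasDerivAt (fun t : ℝ => (ψ (t : ℂ)).im) d.im t0 := by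
      exact (Complex.imCLM.hasFDerivAt.comp_hasDerivAt t0 hder')
    have hexp : HasDerivAt (fun t : ℝ => Real.exp (2 * t)) (Real.exp (2 * t0) * 2) t0 := by
      simpa using ((hasDerivAt_id t0).const_mul 2).exp
    have hmd := ((hre.mul hre).add (him.mul him)).mul hexp
    have hmd' : HasDerivAt m (2 * (1 - (L (1, 0) / (z * L (0, 1))).re) * Complex.normSq z * Real.exp (2 * t0)) t0 := by
      refine (hmd.congr_deriv ?_)
      simp only [Pi.add_apply, Pi.mul_apply]
      rw [hψ0, hdz]
      simp only [Complex.mul_re, Complex.mul_im, Complex.neg_re, Complex.neg_im, Complex.normSq_apply]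
      ring
    have hneg : 2 * (1 - (L (1, 0) / (z * L (0, 1))).re) * Complex.normSq z * Real.exp (2 * t0) < 0 := by
      have : 0 < Complex.normSq z := Complex.normSq_pos.mpr hz0
      have h8 : 2 * (1 - (L (1, 0) / (z * L (0, 1))).re) < 0 := by linarith
      have := mul_neg_of_neg_of_pos h8 this
      exact mul_neg_of_neg_of_pos this (Real.exp_pos _)
    have hs := hmd'.tendsto_slope.mono_left (nhdsWithin_mono t0 (fun x (hx : x ∈ Set.Ioi t0) => ne_of_gt hx))
    filter_upwards [hs.eventually (gt_mem_nhds hneg), self_mem_nhdsWithin] with t ht ht2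
    have ht2 : t0 < t := ht2
    rw [slope_def_field, div_neg_iff] at ht
    have hmt : m t < m t0 := by
      rcases ht with ⟨_, h⟩ | ⟨h, _⟩ <;> linarith
    have hm0 : m t0 = r ^ 2 := by
      simp only [hm, hψ0, Complex.normSq_eq_norm_sq, heq, mul_pow, ← Real.exp_nat_mul]
      rw [mul_assoc, ← Real.exp_add]
      simp
    rw [hm0] at hmt
    simp only [hm, Complex.normSq_eq_norm_sq] at hmt
    have h9 : Real.exp (2 * t) = Real.exp t ^ 2 := by
      rw [← Real.exp_nat_mul]; simp
    rw [h9, ← mul_pow] at hmt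
    have h10 := (abs_lt_of_sq_lt_sq' hmt hr.le).2
    rw [Real.exp_neg, ← div_eq_mul_inv, le_div_iff₀ (Real.exp_pos t)]
    exact h10.le

theorem no_zero (Y : ℂ × ℂ → ℂ) (r T : ℝ) (hr : 0 < r)
    (hcont : ∀ t : ℝ, 0 ≤ t → t ≤ T → ∀ z : ℂ, ‖z‖ ≤ r * Real.exp (-t) → ContinuousAt Y ((t : ℂ), z))
    (hY : ∀ t : ℝ, 0 ≤ t → t ≤ T → ∀ z : ℂ, ‖z‖ ≤ r * Real.exp (-t) → Y ((t : ℂ), z) = 0 →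
      ∃ L : ℂ × ℂ →L[ℂ] ℂ, HasStrictFDerivAt Y L ((t : ℂ), z) ∧ L (0, 1) ≠ 0 ∧
        (‖z‖ = r * Real.exp (-t) → 1 < (L (1, 0) / (z * L (0, 1))).re))
    (hT : ∀ z : ℂ, ‖z‖ ≤ r * Real.exp (-T) → Y ((T : ℂ), z) ≠ 0) :
    ∀ t : ℝ, 0 ≤ t → t ≤ T → ∀ z : ℂ, ‖z‖ ≤ r * Real.exp (-t) → Y ((t : ℂ), z) ≠ 0 := by
  intro t1 h1 h1T z1 hz1 hY1
  let K : Set (ℝ × ℂ) := {p | p.1 ∈ Set.Icc 0 T ∧ ‖p.2‖ ≤ r * Real.exp (-p.1)}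
  have hKc : IsClosed K := by
    refine IsClosed.inter (isClosed_Icc.preimage continuous_fst) ?_
    exact isClosed_le (f := fun p : ℝ × ℂ => ‖p.2‖) (g := fun p : ℝ × ℂ => r * Real.exp (-p.1)) (by fun_prop) (by fun_prop)
  have hK : IsCompact K := by
    refine IsCompact.of_isClosed_subset ((isCompact_Icc (a := (0 : ℝ)) (b := T)).prod (isCompact_closedBall (0 : ℂ) r)) hKc ?_
    rintro ⟨t, z⟩ ⟨h, h'⟩
    refine ⟨h, mem_closedBall_zero_iff.mpr (h'.trans ?_)⟩
    have : Real.exp (-t) ≤ 1 := Real.exp_le_one_iff.mpr (by have := h.1; simp at this; linarith)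
    simpa using mul_le_mul_of_nonneg_left this hr.le
  let C : Set (ℝ × ℂ) := K ∩ {p | Y ((p.1 : ℂ), p.2) = 0}
  have hCK : IsClosed C := by
    have : ContinuousOn (fun p : ℝ × ℂ => Y ((p.1 : ℂ), p.2)) K := by
      rintro ⟨t, z⟩ ⟨h, h'⟩
      refine ContinuousAt.continuousWithinAt ?_
      exact ContinuousAt.comp (f := fun p : ℝ × ℂ => ((p.1 : ℂ), p.2)) (hcont t h.1 h.2 z h') (by fun_prop)
    exact this.preimage_isClosed_of_isClosed hKc isClosed_singleton
  have hC : IsCompact C := hK.of_isClosed_subset hCK Set.inter_subset_left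
  obtain ⟨⟨t0, z0⟩, ⟨⟨ht0, hz0⟩, hY0⟩, hmax⟩ := hC.exists_isMaxOn ⟨(t1, z1), ⟨⟨h1, h1T⟩, hz1⟩, hY1⟩
    (continuous_fst.continuousOn (s := C))
  simp only [Set.mem_Icc] at ht0 hz0
  change Y ((t0 : ℂ), z0) = 0 at hY0
  have hlt : t0 < T := by
    refine lt_of_le_of_ne ht0.2 ?_
    rintro rfl
    exact hT z0 hz0 hY0
  obtain ⟨L, hL, hc, hb⟩ := hY t0 ht0.1 ht0.2 z0 hz0 hY0
  obtain ⟨φ, -, hφ⟩ := slide Y r t0 z0 L hL hc hr hz0 hb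
  have hev : ∀ᶠ t in 𝓝[>] t0, t < T := nhdsWithin_le_nhds (gt_mem_nhds hlt)
  obtain ⟨t, ⟨⟨ha, hb'⟩, ht⟩, htT⟩ := ((hφ.and self_mem_nhdsWithin).and hev).exists
  have ht : t0 < t := ht
  have hmem : (t, φ t) ∈ C := ⟨⟨⟨by linarith [ht0.1], htT.le⟩, hb'⟩, by rw [hY0] at ha; exact ha⟩
  have := hmax hmem
  simp at this
  linarith

theorem local_inj (Θ : ℂ × ℂ → ℂ) (u : ℂ × ℂ) (L : ℂ × ℂ →L[ℂ] ℂ)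
    (h : HasStrictFDerivAt Θ L u) (hc : L (0, 1) ≠ 0) :
    ∀ᶠ p : (ℂ × ℂ) × (ℂ × ℂ) in 𝓝 (u, u), p.1.1 = p.2.1 → Θ p.1 = Θ p.2 → p.1 = p.2 := by
  have hpos : 0 < ‖L (0, 1)‖ / 2 := by positivity
  have := h.isLittleO.def hpos
  filter_upwards [this] with p hp h1 h2
  obtain ⟨⟨a, x⟩, ⟨b, y⟩⟩ := p
  simp only at h1 h2 hp ⊢
  subst h1
  by_contra hne
  have hxy : x ≠ y := by
    rintro rfl; exact hne rfl
  rw [h2] at hp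
  have e : ((a, x) - (a, y) : ℂ × ℂ) = (x - y) • ((0 : ℂ), (1 : ℂ)) := by
    simp
  rw [e, map_smul, norm_smul] at hp
  simp at hp
  have : 0 < ‖x - y‖ := norm_pos_iff.mpr (sub_ne_zero.mpr hxy)
  have h3 : 0 < ‖x - y‖ * ‖L (0, 1)‖ := by positivity
  nlinarith

theorem inj_slide (Θ : ℂ × ℂ → ℂ) (r T : ℝ) (hr : 0 < r) (hT0 : 0 ≤ T)
    (hY : ∀ t : ℝ, 0 ≤ t → t ≤ T → ∀ z : ℂ, ‖z‖ ≤ r * Real.exp (-t) →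
      ∃ L : ℂ × ℂ →L[ℂ] ℂ, HasStrictFDerivAt Θ L ((t : ℂ), z) ∧ L (0, 1) ≠ 0 ∧
        (‖z‖ = r * Real.exp (-t) → 1 < (L (1, 0) / (z * L (0, 1))).re))
    (hT : ∀ z w : ℂ, ‖z‖ ≤ r * Real.exp (-T) → ‖w‖ ≤ r * Real.exp (-T) →
      Θ ((T : ℂ), z) = Θ ((T : ℂ), w) → z = w) :
    ∀ z w : ℂ, ‖z‖ ≤ r → ‖w‖ ≤ r → Θ (0, z) = Θ (0, w) → z = w := by
  intro z1 w1 hz1 hw1 hY1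
  by_contra hne1
  let K : Set (ℝ × ℂ × ℂ) := {p | p.1 ∈ Set.Icc 0 T ∧ ‖p.2.1‖ ≤ r * Real.exp (-p.1) ∧ ‖p.2.2‖ ≤ r * Real.exp (-p.1)}
  have hKc : IsClosed K := by
    refine IsClosed.inter (isClosed_Icc.preimage continuous_fst) (IsClosed.inter ?_ ?_)
    · exact isClosed_le (f := fun p : ℝ × ℂ × ℂ => ‖p.2.1‖) (g := fun p : ℝ × ℂ × ℂ => r * Real.exp (-p.1)) (by fun_prop) (by fun_prop)
    · exact isClosed_le (f := fun p : ℝ × ℂ × ℂ => ‖p.2.2‖) (g := fun p : ℝ × ℂ × ℂ => r * Real.exp (-p.1)) (by fun_prop) (by fun_prop)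
  have hK : IsCompact K := by
    refine IsCompact.of_isClosed_subset ((isCompact_Icc (a := (0 : ℝ)) (b := T)).prod ((isCompact_closedBall (0 : ℂ) r).prod (isCompact_closedBall (0 : ℂ) r))) hKc ?_
    rintro ⟨t, z, w⟩ ⟨h, h', h''⟩
    have : Real.exp (-t) ≤ 1 := Real.exp_le_one_iff.mpr (by have := h.1; simp at this; linarith)
    have : r * Real.exp (-t) ≤ r := by simpa using mul_le_mul_of_nonneg_left this hr.le
    exact ⟨h, mem_closedBall_zero_iff.mpr (h'.trans this), mem_closedBall_zero_iff.mpr (h''.trans this)⟩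
  let C : Set (ℝ × ℂ × ℂ) := {p | p ∈ K ∧ Θ ((p.1 : ℂ), p.2.1) = Θ ((p.1 : ℂ), p.2.2) ∧ p.2.1 ≠ p.2.2}
  have hCcl : IsClosed C := by
    rw [isClosed_iff_frequently]
    rintro ⟨t, z, w⟩ hfr
    have hKm : (t, z, w) ∈ K := (isClosed_iff_frequently.mp hKc) _ (hfr.mono fun p hp => hp.1)
    obtain ⟨h, h', h''⟩ := id hKm
    simp only [Set.mem_Icc] at h h' h''
    obtain ⟨L, hL, hc, -⟩ := hY t h.1 h.2 z h'
    obtain ⟨L2, hL2, -, -⟩ := hY t h.1 h.2 w h''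
    have c1 : ContinuousAt (fun p : ℝ × ℂ × ℂ => Θ ((p.1 : ℂ), p.2.1)) (t, z, w) :=
      ContinuousAt.comp (f := fun p : ℝ × ℂ × ℂ => ((p.1 : ℂ), p.2.1)) hL.continuousAt (by fun_prop)
    have c2 : ContinuousAt (fun p : ℝ × ℂ × ℂ => Θ ((p.1 : ℂ), p.2.2)) (t, z, w) :=
      ContinuousAt.comp (f := fun p : ℝ × ℂ × ℂ => ((p.1 : ℂ), p.2.2)) hL2.continuousAt (by fun_prop)
    have heq : Θ ((t : ℂ), z) = Θ ((t : ℂ), w) := by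
      by_contra hne
      have : ∀ᶠ p in 𝓝 (t, z, w), Θ ((p.1 : ℂ), p.2.1) ≠ Θ ((p.1 : ℂ), p.2.2) := ev_ne c1 c2 hne
      exact hfr (this.mono fun p hp hp2 => hp hp2.2.1)
    refine ⟨hKm, heq, ?_⟩
    intro hzw
    simp only at hzw
    subst hzw
    have hl := local_inj Θ _ L hL hc
    have ct : Tendsto (fun p : ℝ × ℂ × ℂ => (((p.1 : ℂ), p.2.1), ((p.1 : ℂ), p.2.2))) (𝓝 (t, z, z))
        (𝓝 (((t : ℂ), z), ((t : ℂ), z))) :=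
      (by fun_prop : Continuous (fun p : ℝ × ℂ × ℂ => (((p.1 : ℂ), p.2.1), ((p.1 : ℂ), p.2.2)))).tendsto (t, z, z)
    refine hfr ((ct.eventually hl).mono fun p hp hp2 => ?_)
    have := hp rfl hp2.2.1
    exact hp2.2.2 (congrArg Prod.snd this)
  have hC : IsCompact C := hK.of_isClosed_subset hCcl fun p hp => hp.1
  obtain ⟨⟨t0, z0, w0⟩, ⟨⟨ht0, hz0, hw0⟩, hY0, hne0⟩, hmax⟩ := hC.exists_isMaxOn
    ⟨(0, z1, w1), ⟨⟨by simp, hT0⟩, by simpa using hz1, by simpa using hw1⟩, by simpa using hY1, hne1⟩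
    (continuous_fst.continuousOn (s := C))
  simp only [Set.mem_Icc] at ht0 hz0 hw0 hY0 hne0
  have hlt : t0 < T := by
    refine lt_of_le_of_ne ht0.2 ?_
    rintro rfl
    exact hne0 (hT z0 w0 hz0 hw0 hY0)
  obtain ⟨L, hL, hc, hb⟩ := hY t0 ht0.1 ht0.2 z0 hz0
  obtain ⟨φ, hφ1, hφ⟩ := slide Θ r t0 z0 L hL hc hr hz0 hb
  obtain ⟨L', hL', hc', hb'⟩ := hY t0 ht0.1 ht0.2 w0 hw0
  obtain ⟨φ', hφ1', hφ'⟩ := slide Θ r t0 w0 L' hL' hc' hr hw0 hb'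
  have hev : ∀ᶠ t in 𝓝[>] t0, t < T := nhdsWithin_le_nhds (gt_mem_nhds hlt)
  have hne : ∀ᶠ t in 𝓝[>] t0, φ t ≠ φ' t := ev_ne hφ1 hφ1' hne0
  obtain ⟨t, ⟨⟨⟨⟨ha, hb⟩, ht⟩, htT⟩, hn⟩, ha', hb'⟩ := ((((hφ.and self_mem_nhdsWithin).and hev).and hne).and hφ').exists
  have ht : t0 < t := ht
  have hmem : (t, φ t, φ' t) ∈ C := ⟨⟨⟨by linarith [ht0.1], htT.le⟩, hb, hb'⟩, by simp only [ha, ha', hY0], hn⟩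
  have := hmax hmem
  simp at this
  linarith

theorem key_ineq (n t : ℝ) (hn : 1 ≤ n) (ht : 0 ≤ t) (w : ℂ) (hw : ‖w‖ ≤ Real.exp (-t)) :
    ‖((1 - Real.exp (-(2 * n * t)) : ℝ) : ℂ) * (w / (1 - w)) - ((n * Real.exp (-(2 * n * t)) : ℝ) : ℂ)‖
      ≤ 2 * n - 1 := by
  rcases ht.eq_or_lt with rfl | ht
  · simp
    rw [abs_of_nonneg] <;> linarith
  set ρ := Real.exp (-t) with hρ
  have hρ0 : 0 < ρ := Real.exp_pos _
  have hρ1 : ρ < 1 := by rw [hρ]; exact Real.exp_lt_one_iff.mpr (by linarith)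
  set R := Real.exp (-(2 * n * t)) with hR
  have hR0 : 0 < R := Real.exp_pos _
  have hR1 : R ≤ 1 := Real.exp_le_one_iff.mpr (by have : 0 ≤ n * t := by positivity
                                                  linarith)
  have hRρ : R = ρ * ρ ^ (2 * n - 1) := by
    rw [hR, hρ, ← Real.exp_mul, ← Real.exp_add]; congr 1; ring
  have hRρ2 : R = ρ ^ 2 * (ρ ^ 2) ^ (n - 1) := by
    rw [hR, hρ, ← Real.exp_nat_mul, ← Real.exp_mul, ← Real.exp_add]; congr 1; push_cast; ring
  have hRρ3 : R = (ρ ^ 2) ^ n := by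
    rw [hR, hρ, ← Real.exp_nat_mul, ← Real.exp_mul]; congr 1; push_cast; ring
  have hb1 : 1 - ρ ^ (2 * n - 1) ≤ (2 * n - 1) * (1 - ρ) := by
    have := one_add_mul_self_le_rpow_one_add (s := ρ - 1) (by linarith) (p := 2 * n - 1) (by linarith)
    rw [show 1 + (ρ - 1) = ρ by ring] at this
    linarith
  have hρ2 : ρ ^ 2 < 1 := by nlinarith
  -- n R ≤ ρ²(1-R)/(1-ρ²)
  have hb2 : n * R * (1 - ρ ^ 2) ≤ ρ ^ 2 * (1 - R) := by
    -- with y = 1/ρ² : y^n ≥ 1 + n(y-1)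
    have hy : 0 < ρ ^ 2 := by positivity
    have h1y : 1 ≤ (ρ ^ 2)⁻¹ := by
      rw [one_le_inv₀ hy]; exact hρ2.le
    have := one_add_mul_self_le_rpow_one_add (s := (ρ ^ 2)⁻¹ - 1) (by linarith) (p := n) hn
    rw [show 1 + ((ρ ^ 2)⁻¹ - 1) = (ρ ^ 2)⁻¹ by ring, Real.inv_rpow hy.le, ← hRρ3] at this
    have h2 := mul_le_mul_of_nonneg_left this (by positivity : 0 ≤ R * ρ ^ 2)
    have e1 : R * ρ ^ 2 * R⁻¹ = ρ ^ 2 := by field_simp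
    have e2 : R * ρ ^ 2 * (1 + n * ((ρ ^ 2)⁻¹ - 1)) = R * ρ ^ 2 + n * R * (1 - ρ ^ 2) := by
      field_simp
    rw [e1, e2] at h2
    linarith
  have hw1 : ‖w‖ < 1 := lt_of_le_of_lt hw hρ1
  have hw0 : 1 - w ≠ 0 := by
    intro h
    have : w = 1 := by linear_combination -h
    rw [this] at hw1; simp at hw1
  have hd : 0 < 1 - ρ ^ 2 := by linarith
  have hdC : (1 - (ρ : ℂ) ^ 2) ≠ 0 := by exact_mod_cast hd.ne'
  have hdisk : ‖w / (1 - w) - ((ρ ^ 2 / (1 - ρ ^ 2) : ℝ) : ℂ)‖ ≤ ρ / (1 - ρ ^ 2) := by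
    have e : w / (1 - w) - ((ρ ^ 2 / (1 - ρ ^ 2) : ℝ) : ℂ) = (w - (ρ ^ 2 : ℝ)) / ((1 - w) * ((1 - ρ ^ 2 : ℝ) : ℂ)) := by
      push_cast
      field_simp
      ring
    rw [e, norm_div, norm_mul, Complex.norm_real, Real.norm_of_nonneg hd.le, ← div_div]
    refine div_le_div_of_nonneg_right ?_ hd.le
    rw [div_le_iff₀ (norm_pos_iff.mpr hw0)]
    refine le_of_sq_le_sq ?_ (by positivity)
    rw [mul_pow, ← Complex.normSq_eq_norm_sq, ← Complex.normSq_eq_norm_sq]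
    have h5 : Complex.normSq w ≤ ρ ^ 2 := by
      rw [Complex.normSq_eq_norm_sq]; gcongr
    simp only [Complex.normSq_apply, Complex.sub_re, Complex.sub_im, Complex.ofReal_re, Complex.ofReal_im, Complex.one_re, Complex.one_im] at h5 ⊢
    nlinarith [mul_le_mul_of_nonneg_right h5 hd.le]
  have h1R : 0 ≤ 1 - R := by linarith
  have e : ((1 - R : ℝ) : ℂ) * (w / (1 - w)) - ((n * R : ℝ) : ℂ) =
      ((1 - R : ℝ) : ℂ) * (w / (1 - w) - ((ρ ^ 2 / (1 - ρ ^ 2) : ℝ) : ℂ)) + ((ρ ^ 2 * (1 - R) / (1 - ρ ^ 2) - n * R : ℝ) : ℂ) := by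
    push_cast; ring
  rw [e]
  refine (norm_add_le _ _).trans ?_
  have hnn : 0 ≤ ρ ^ 2 * (1 - R) / (1 - ρ ^ 2) - n * R := by
    rw [sub_nonneg, le_div_iff₀ hd]; exact hb2
  rw [norm_mul, Complex.norm_real, Complex.norm_real, Real.norm_of_nonneg h1R, Real.norm_of_nonneg hnn]
  have h6 := mul_le_mul_of_nonneg_left hdisk h1R
  have h7 : (1 - R) * (ρ / (1 - ρ ^ 2)) + ρ ^ 2 * (1 - R) / (1 - ρ ^ 2) = ρ * (1 - R) / (1 - ρ) := by
    have : 1 - ρ ≠ 0 := by linarith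
    have : 1 - ρ ^ 2 ≠ 0 := hd.ne'
    field_simp
    ring
  have h8 : ρ * (1 - R) / (1 - ρ) - n * R ≤ 2 * n - 1 := by
    rw [sub_le_iff_le_add, div_le_iff₀ (by linarith)]
    have h9 := mul_le_mul_of_nonneg_left hb1 hρ0.le
    have h10 : ρ - R ≤ ρ * ((2 * n - 1) * (1 - ρ)) := by rw [hRρ]; linarith
    have h11 : 0 ≤ (n - 1) * R * (1 - ρ) := by
      have : 0 ≤ n - 1 := by linarith
      have : 0 ≤ 1 - ρ := by linarith
      positivity
    nlinarith [mul_nonneg (mul_nonneg (by linarith : 0 ≤ 2 * n - 1) (by linarith : 0 ≤ 1 - ρ)) (by linarith : 0 ≤ 1 - ρ)]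
  linarith

/-- the Loewner condition -/
theorem loewner_cond (n t : ℝ) (hn : 1 ≤ n) (ht : 0 ≤ t) (w ε β : ℂ) (hw : ‖w‖ ≤ Real.exp (-t))
    (hε : 2 * ‖ε‖ * (2 * n - 1) < 1) (hβ : β * (1 - 2 * n * ε) = 1) (P : ℂ)
    (hP : P = n * (1 + 2 * ε * (w / (1 - w)))) :
    1 + β * (Complex.exp (2 * n * t) - 1) * P / n ≠ 0 ∧
    1 < (2 * β * Complex.exp (2 * n * t) / (1 + β * (Complex.exp (2 * n * t) - 1) * P / n)).re := by
  have hk := key_ineq n t hn ht w hw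
  have hn0 : (n : ℂ) ≠ 0 := by exact_mod_cast (by linarith : n ≠ 0)
  have hβ0 : β ≠ 0 := by rintro rfl; simp at hβ
  set E := Complex.exp (2 * n * t) with hE
  have hE0 : E ≠ 0 := Complex.exp_ne_zero _
  set X := 1 + β * (E - 1) * P / n with hX
  have hRE : ((Real.exp (-(2 * n * t)) : ℝ) : ℂ) = E⁻¹ := by
    rw [hE, ← Complex.exp_neg]; push_cast; rfl
  have hXe : 2 * X - 2 * β * E = 2 * β * E * (2 * ε * (((1 - Real.exp (-(2 * n * t)) : ℝ) : ℂ) * (w / (1 - w)) - ((n * Real.exp (-(2 * n * t)) : ℝ) : ℂ))) := by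
    rw [hX, hP]
    rw [Complex.ofReal_sub, Complex.ofReal_mul, hRE, Complex.ofReal_one]
    generalize w / (1 - w) = v
    field_simp
    linear_combination -hβ
  have hlt : ‖2 * X - 2 * β * E‖ < ‖2 * β * E‖ := by
    rw [hXe, norm_mul]
    have hpos : 0 < ‖2 * β * E‖ := norm_pos_iff.mpr (by simp [hβ0, hE0])
    refine mul_lt_of_lt_one_right hpos ?_
    rw [norm_mul, norm_mul]
    simp only [Complex.norm_ofNat]
    refine lt_of_le_of_lt ?_ hε
    exact mul_le_mul_of_nonneg_left hk (by positivity)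
  have hX0 : X ≠ 0 := by
    intro h
    rw [h] at hlt; simp at hlt
  refine ⟨hX0, ?_⟩
  generalize 2 * β * E = Z at hlt
  have h2 : ‖2 * X - Z‖ ^ 2 < ‖Z‖ ^ 2 := by gcongr
  rw [← Complex.normSq_eq_norm_sq, ← Complex.normSq_eq_norm_sq] at h2
  have h3 : 0 < Complex.normSq X := Complex.normSq_pos.mpr hX0
  rw [Complex.div_re, ← add_div, lt_div_iff₀ h3]
  simp only [Complex.normSq_apply, Complex.sub_re, Complex.sub_im, Complex.mul_re, Complex.mul_im, Complex.re_ofNat, Complex.im_ofNat] at h2 ⊢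
  linarith

theorem partials (Θ : ℂ × ℂ → ℂ) (a b c d : ℂ) (h : AnalyticAt ℂ Θ (a, b))
    (h1 : HasDerivAt (fun z => Θ (a, z)) c b) (h2 : HasDerivAt (fun t => Θ (t, b)) d a) :
    ∃ L : ℂ × ℂ →L[ℂ] ℂ, HasStrictFDerivAt Θ L (a, b) ∧ L (0, 1) = c ∧ L (1, 0) = d := by
  refine ⟨_, h.hasStrictFDerivAt, ?_, ?_⟩
  · have e : HasDerivAt (fun z : ℂ => (a, z)) ((0 : ℂ), (1 : ℂ)) b :=
      (hasDerivAt_const b a).prodMk (hasDerivAt_id b)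
    exact (h.hasStrictFDerivAt.hasFDerivAt.comp_hasDerivAt b e).unique h1
  · have e : HasDerivAt (fun t : ℂ => (t, b)) ((1 : ℂ), (0 : ℂ)) a :=
      (hasDerivAt_id a).prodMk (hasDerivAt_const a b)
    exact (h.hasStrictFDerivAt.hasFDerivAt.comp_hasDerivAt a e).unique h2

theorem log_mul_re_pos (a b : ℂ) (ha : 0 < a.re) (hb : 0 < b.re) :
    Complex.log (a * b) = Complex.log a + Complex.log b := by
  have ha0 : a ≠ 0 := by rintro rfl; simp at ha
  have hb0 : b ≠ 0 := by rintro rfl; simp at hb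
  rw [Complex.log_mul_eq_add_log_iff ha0 hb0]
  have h1 := abs_lt.mp (Complex.abs_arg_lt_pi_div_two_iff.mpr (Or.inl ha))
  have h2 := abs_lt.mp (Complex.abs_arg_lt_pi_div_two_iff.mpr (Or.inl hb))
  constructor <;> linarith [h1.1, h1.2, h2.1, h2.2]

theorem subord (lam n : ℝ) (hn : 1 ≤ n) (hcos : 0 < Real.cos lam) (P : ℂ → ℂ)
    (hP : DifferentiableOn ℂ P (ball (0 : ℂ) 1)) (hP0 : P 0 = n)
    (hre : ∀ z ∈ ball (0 : ℂ) 1, 0 < (Complex.exp (-(lam : ℂ) * Complex.I) * P z).re) :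
    ∀ z ∈ ball (0 : ℂ) 1, ∃ w : ℂ, ‖w‖ ≤ ‖z‖ ∧
      P z = n * (1 + 2 * (Complex.exp (lam * Complex.I) * Real.cos lam) * (w / (1 - w))) := by
  have hn0 : (n : ℂ) ≠ 0 := by exact_mod_cast (by linarith : n ≠ 0)
  have hc0 : ((Real.cos lam : ℝ) : ℂ) ≠ 0 := by exact_mod_cast hcos.ne'
  set h : ℂ → ℂ := fun z => (Complex.exp (-(lam : ℂ) * Complex.I) * P z / n + Real.sin lam * Complex.I) / Real.cos lam with hh
  have hexp : Complex.exp (-(lam : ℂ) * Complex.I) = Real.cos lam - Real.sin lam * Complex.I := by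
    rw [Complex.exp_mul_I]; simp [sub_eq_add_neg]
  have hexp2 : Complex.exp ((lam : ℂ) * Complex.I) * Complex.exp (-(lam : ℂ) * Complex.I) = 1 := by
    rw [← Complex.exp_add]; simp
  have hd : DifferentiableOn ℂ h (ball (0 : ℂ) 1) := by
    simp only [hh]; fun_prop
  have hhre : ∀ z ∈ ball (0 : ℂ) 1, 0 < (h z).re := by
    intro z hz
    have : (h z).re = (Complex.exp (-(lam : ℂ) * Complex.I) * P z).re / n / Real.cos lam := by
      simp only [hh]
      rw [Complex.div_ofReal_re, Complex.add_re, Complex.div_ofReal_re]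
      simp
    rw [this]
    have := hre z hz
    positivity
  have h0 : h 0 = 1 := by
    simp only [hh, hP0, hexp]; field_simp; ring
  have hp1 : ∀ z ∈ ball (0 : ℂ) 1, h z + 1 ≠ 0 := by
    intro z hz he
    have := hhre z hz
    have e : h z = -1 := by linear_combination he
    rw [e] at this; simp at this; linarith
  have hwd : DifferentiableOn ℂ (fun z => (h z - 1) / (h z + 1)) (ball (0 : ℂ) 1) :=
    (hd.sub_const 1).div (hd.add_const 1) hp1
  have hmaps : Set.MapsTo (fun z => (h z - 1) / (h z + 1)) (ball (0 : ℂ) 1) (closedBall 0 1) := by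
    intro z hz
    rw [mem_closedBall_zero_iff, norm_div, div_le_one (norm_pos_iff.mpr (hp1 z hz))]
    refine le_of_sq_le_sq ?_ (norm_nonneg _)
    rw [← Complex.normSq_eq_norm_sq, ← Complex.normSq_eq_norm_sq]
    have := hhre z hz
    simp only [Complex.normSq_apply, Complex.sub_re, Complex.sub_im, Complex.add_re, Complex.add_im, Complex.one_re, Complex.one_im]
    nlinarith
  intro z hz
  refine ⟨(h z - 1) / (h z + 1), ?_, ?_⟩
  · exact Complex.norm_le_norm_of_mapsTo_ball hwd hmaps (by simp [h0]) (mem_ball_zero_iff.mp hz)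
  · have := hp1 z hz
    have e : (h z - 1) / (h z + 1) / (1 - (h z - 1) / (h z + 1)) = (h z - 1) / 2 := by
      have e2 : 1 - (h z - 1) / (h z + 1) = 2 / (h z + 1) := by field_simp; ring
      rw [e2]; field_simp
    rw [e]
    simp only [hh]
    rw [hexp] at hexp2 ⊢
    field_simp
    linear_combination (-(P z) + n) * hexp2

theorem core (n r : ℝ) (hn : 1 ≤ n) (hr : 0 < r) (hr1 : r < 1) (ε β : ℂ)
    (hε : 2 * ‖ε‖ * (2 * n - 1) < 1) (hβ : β * (1 - 2 * n * ε) = 1)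
    (f f1 f2 g g1 P : ℂ → ℂ)
    (af : ∀ z ∈ ball (0 : ℂ) 1, AnalyticAt ℂ f z) (af1 : ∀ z ∈ ball (0 : ℂ) 1, AnalyticAt ℂ f1 z)
    (ag : ∀ z ∈ ball (0 : ℂ) 1, AnalyticAt ℂ g z)
    (df : ∀ z ∈ ball (0 : ℂ) 1, HasDerivAt f (f1 z) z)
    (df1 : ∀ z ∈ ball (0 : ℂ) 1, HasDerivAt f1 (f2 z) z)
    (dg : ∀ z ∈ ball (0 : ℂ) 1, HasDerivAt g (g1 z) z)
    (hfg : ∀ z ∈ ball (0 : ℂ) 1, f z = z * g z)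
    (hg1 : ∀ z ∈ ball (0 : ℂ) 1, z * g1 z = f1 z - g z)
    (hg0 : ∀ z ∈ ball (0 : ℂ) 1, g z ≠ 0)
    (hf10 : ∀ z ∈ ball (0 : ℂ) 1, f1 z ≠ 0)
    (g_zero : g 0 = 1) (f1_zero : f1 0 = 1)
    (hP : ∀ z ∈ ball (0 : ℂ) 1, P z = 1 + z * f2 z / f1 z + (n - 1) * (f1 z / g z))
    (hPw : ∀ z ∈ ball (0 : ℂ) 1, ∃ w : ℂ, ‖w‖ ≤ ‖z‖ ∧ P z = n * (1 + 2 * ε * (w / (1 - w)))) :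
    ∀ z w : ℂ, ‖z‖ ≤ r → ‖w‖ ≤ r → f z = f w → z = w := by
  have hn0 : (n : ℂ) ≠ 0 := by exact_mod_cast (by linarith : n ≠ 0)
  have hβ0 : β ≠ 0 := by rintro rfl; simp at hβ
  have hβre : 0 < β.re := by
    have e : β = (1 - 2 * n * ε)⁻¹ := eq_inv_of_mul_eq_one_left hβ
    have h1 : ‖2 * (n : ℂ) * ε‖ < 1 := by
      rw [norm_mul, norm_mul, Complex.norm_real, Real.norm_of_nonneg (by linarith)]
      simp only [Complex.norm_ofNat]
      nlinarith [norm_nonneg ε]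
    have h2 := (Complex.re_le_norm (2 * (n : ℂ) * ε)).trans_lt h1
    have h3 : 0 < (1 - 2 * n * ε).re := by rw [Complex.sub_re, Complex.one_re]; linarith
    rw [e, Complex.inv_re]
    refine div_pos h3 (Complex.normSq_pos.mpr ?_)
    intro h; rw [h] at h3; simp at h3
  have hball : ∀ t : ℝ, 0 ≤ t → ∀ z : ℂ, ‖z‖ ≤ r * Real.exp (-t) → z ∈ ball (0 : ℂ) 1 := by
    intro t ht z hz
    have : Real.exp (-t) ≤ 1 := Real.exp_le_one_iff.mpr (by linarith)
    rw [mem_ball_zero_iff]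
    nlinarith
  set A : ℂ → ℂ := fun t => β * (Complex.exp (2 * n * t) - 1) with hA
  have dA : ∀ t : ℂ, HasDerivAt A (2 * n * β * Complex.exp (2 * n * t)) t := by
    intro t
    have h1 : HasDerivAt (fun t : ℂ => 2 * (n : ℂ) * t) (2 * n) t := by
      simpa using (hasDerivAt_id t).const_mul (2 * (n : ℂ))
    refine ((h1.cexp.sub_const 1).const_mul β).congr_deriv ?_
    ring
  have aA : ∀ t : ℂ, AnalyticAt ℂ A t := by
    intro t; simp only [hA]; fun_prop
  have hX : ∀ t : ℝ, 0 ≤ t → ∀ z : ℂ, ‖z‖ ≤ r * Real.exp (-t) →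
      1 + A t * P z / n ≠ 0 ∧ 1 < (2 * β * Complex.exp (2 * n * t) / (1 + A t * P z / n)).re := by
    intro t ht z hz
    obtain ⟨w, hw, hPz⟩ := hPw z (hball t ht z hz)
    refine loewner_cond n t hn ht w ε β (hw.trans (hz.trans ?_)) hε hβ (P z) hPz
    have := Real.exp_pos (-t)
    nlinarith
  have h0mem : (0 : ℂ) ∈ ball (0 : ℂ) 1 := by simp
  have f_zero : f 0 = 0 := by rw [hfg 0 h0mem]; simp
  -- the auxiliary function at infinity
  set Ξ : ℂ × ℂ → ℂ := fun u => f u.2 * Complex.exp ((1 / n) * Complex.log (u.1 + f1 u.2 / g u.2)) with hΞ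
  set Θ : ℂ × ℂ → ℂ := fun u => f u.2 * Complex.exp ((1 / n) * Complex.log (1 + A u.1 * (f1 u.2 / g u.2))) with hΘ
  set Y : ℂ × ℂ → ℂ := fun u => g u.2 + A u.1 * f1 u.2 with hYdef
  have ap : ∀ z ∈ ball (0 : ℂ) 1, AnalyticAt ℂ (fun z => f1 z / g z) z := fun z hz =>
    (af1 z hz).div (ag z hz) (hg0 z hz)
  have asnd : ∀ (F : ℂ → ℂ) (u : ℂ × ℂ), AnalyticAt ℂ F u.2 → AnalyticAt ℂ (fun u : ℂ × ℂ => F u.2) u :=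
    fun F u hF => hF.comp (f := fun u : ℂ × ℂ => u.2) analyticAt_snd
  have afst : ∀ (F : ℂ → ℂ) (u : ℂ × ℂ), AnalyticAt ℂ F u.1 → AnalyticAt ℂ (fun u : ℂ × ℂ => F u.1) u :=
    fun F u hF => hF.comp (f := fun u : ℂ × ℂ => u.1) analyticAt_fst
  have hlarge : ∃ T : ℝ, 0 ≤ T ∧ (∀ z : ℂ, ‖z‖ ≤ r * Real.exp (-T) → Y ((T : ℂ), z) ≠ 0) ∧
      (∀ z w : ℂ, ‖z‖ ≤ r * Real.exp (-T) → ‖w‖ ≤ r * Real.exp (-T) →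
        Θ ((T : ℂ), z) = Θ ((T : ℂ), w) → z = w) := by
    have aΞ : AnalyticAt ℂ Ξ (0, 0) := by
      refine (asnd f (0, 0) (af 0 h0mem)).mul ?_
      refine (analyticAt_const.mul (AnalyticAt.clog ?_ ?_)).cexp
      · exact analyticAt_fst.add (asnd _ (0, 0) (ap 0 h0mem))
      · simp [g_zero, f1_zero]
    have dΞ : HasDerivAt (fun z => Ξ (0, z)) 1 0 := by
      have h1 : DifferentiableAt ℂ (fun z : ℂ => Complex.exp ((1 / n) * Complex.log (0 + f1 z / g z))) 0 := by
        refine (DifferentiableAt.const_mul (DifferentiableAt.clog ?_ ?_) _).cexp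
        · exact (ap 0 h0mem).differentiableAt.const_add 0
        · simp [g_zero, f1_zero]
      refine ((df 0 h0mem).mul h1.hasDerivAt).congr_deriv ?_
      simp [g_zero, f1_zero, f_zero]
    have hfst : DifferentiableAt ℂ (fun t => Ξ (t, 0)) 0 :=
      DifferentiableAt.comp (0 : ℂ) (f := fun t : ℂ => (t, (0 : ℂ))) aΞ.differentiableAt (by fun_prop)
    obtain ⟨L, hL, hL1, -⟩ := partials Ξ 0 0 _ _ aΞ dΞ hfst.hasDerivAt
    have hloc := local_inj Ξ _ L hL (by rw [hL1]; exact one_ne_zero)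
    obtain ⟨δ, hδ, hloc⟩ := Metric.eventually_nhds_iff.mp hloc
    have hpre : ∀ᶠ z in 𝓝 (0 : ℂ), 0 < (f1 z / g z).re := by
      have hc : ContinuousAt (fun z => (f1 z / g z).re) 0 :=
        Complex.continuous_re.continuousAt.comp (ap 0 h0mem).continuousAt
      refine hc.eventually (lt_mem_nhds ?_)
      simp [g_zero, f1_zero]
    obtain ⟨δ', hδ', hpre⟩ := Metric.eventually_nhds_iff.mp hpre
    have t1 : Tendsto (fun T : ℝ => r * Real.exp (-T)) atTop (𝓝 0) := by
      simpa using (Real.tendsto_exp_neg_atTop_nhds_zero).const_mul r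
    have t2 : Tendsto (fun T : ℝ => (A T)⁻¹) atTop (𝓝 0) := by
      have e : (fun T : ℝ => (A T)⁻¹) = fun T : ℝ => β⁻¹ * (((Real.exp (2 * n * T) - 1)⁻¹ : ℝ) : ℂ) := by
        funext T
        simp only [hA]
        push_cast
        rw [mul_inv]
      rw [e]
      have t3 : Tendsto (fun T : ℝ => Real.exp (2 * n * T) - 1) atTop atTop := by
        refine tendsto_atTop_add_const_right _ (-1) ?_
        refine Real.tendsto_exp_atTop.comp ?_
        exact tendsto_id.const_mul_atTop (by linarith)
      have t4 := (Complex.continuous_ofReal.tendsto 0).comp t3.inv_tendsto_atTop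
      simpa using t4.const_mul β⁻¹
    obtain ⟨T, ⟨hT1, hT2⟩, hT3, hT4⟩ := (((t1.eventually (gt_mem_nhds hδ)).and (t1.eventually (gt_mem_nhds hδ'))).and
      ((t2.eventually (Metric.ball_mem_nhds 0 hδ)).and (eventually_gt_atTop (0 : ℝ)))).exists
    have hApos : 0 < (A T).re := by
      have e : A T = β * ((Real.exp (2 * n * T) - 1 : ℝ) : ℂ) := by
        simp only [hA]; push_cast; rfl
      rw [e, Complex.re_mul_ofReal]
      refine mul_pos hβre (sub_pos.mpr (Real.one_lt_exp_iff.mpr ?_))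
      have : 0 < n := by linarith
      positivity
    have hA0 : A T ≠ 0 := by intro h; rw [h] at hApos; simp at hApos
    have hAinv : 0 < ((A T)⁻¹).re := by
      rw [Complex.inv_re]; exact div_pos hApos (Complex.normSq_pos.mpr hA0)
    have hsum : ∀ z : ℂ, ‖z‖ ≤ r * Real.exp (-T) → 0 < ((A T)⁻¹ + f1 z / g z).re := by
      intro z hz
      rw [Complex.add_re]
      have := hpre (show dist z 0 < δ' by rw [dist_zero_right]; linarith)
      linarith
    have hfac : ∀ z : ℂ, 1 + A T * (f1 z / g z) = A T * ((A T)⁻¹ + f1 z / g z) := by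
      intro z; rw [mul_add, mul_inv_cancel₀ hA0]
    refine ⟨T, hT4.le, ?_, ?_⟩
    · intro z hz h
      have hgz := hg0 z (hball T hT4.le z hz)
      have e : g z + A T * f1 z = g z * (A T * ((A T)⁻¹ + f1 z / g z)) := by
        rw [← hfac]; field_simp
      simp only [hYdef] at h
      rw [e] at h
      have h2 := hsum z hz
      rcases mul_eq_zero.mp h with h | h
      · exact hgz h
      · rcases mul_eq_zero.mp h with h | h
        · exact hA0 h
        · rw [h] at h2; simp at h2
    · have hΘΞ : ∀ z : ℂ, ‖z‖ ≤ r * Real.exp (-T) →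
          Θ ((T : ℂ), z) = Complex.exp ((1 / n) * Complex.log (A T)) * Ξ ((A T)⁻¹, z) := by
        intro z hz
        simp only [hΘ, hΞ]
        rw [hfac, log_mul_re_pos _ _ hApos (hsum z hz), mul_add, Complex.exp_add]
        ring
      intro z w hz hw h
      rw [hΘΞ z hz, hΘΞ w hw] at h
      have h := mul_left_cancel₀ (Complex.exp_ne_zero _) h
      have hT3' : ‖(A T)⁻¹‖ < δ := by simpa using hT3
      have := hloc (y := (((A T)⁻¹, z), ((A T)⁻¹, w))) (by
        simp only [Prod.dist_eq, dist_zero_right]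
        have := hz.trans_lt hT1
        have := hw.trans_lt hT1
        simp only [max_lt_iff]
        tauto) rfl h
      exact congrArg Prod.snd this
  obtain ⟨T, hT0, hYT, hΘT⟩ := hlarge
  have aY : ∀ t z : ℂ, z ∈ ball (0 : ℂ) 1 → AnalyticAt ℂ Y (t, z) := fun t z hz =>
    (asnd g (t, z) (ag z hz)).add ((afst A (t, z) (aA t)).mul (asnd f1 (t, z) (af1 z hz)))
  have hYne : ∀ t : ℝ, 0 ≤ t → t ≤ T → ∀ z : ℂ, ‖z‖ ≤ r * Real.exp (-t) → Y ((t : ℂ), z) ≠ 0 := by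
    refine no_zero Y r T hr (fun t ht _ z hz => (aY t z (hball t ht z hz)).continuousAt) ?_ hYT
    intro t ht htT z hz hYz
    have hzb := hball t ht z hz
    have hf1z := hf10 z hzb
    have hgz := hg0 z hzb
    obtain ⟨hX0, hX1⟩ := hX t ht z hz
    have hz0 : z ≠ 0 := by
      rintro rfl
      apply hX0
      rw [hP 0 h0mem]
      simp only [hYdef, g_zero, f1_zero] at hYz ⊢
      field_simp
      linear_combination n * hYz
    have d1 : HasDerivAt (fun z => Y ((t : ℂ), z)) (g1 z + A t * f2 z) z :=
      (dg z hzb).add ((df1 z hzb).const_mul (A t))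
    have d2 : HasDerivAt (fun t => Y (t, z)) (2 * n * β * Complex.exp (2 * n * t) * f1 z) (t : ℂ) :=
      ((dA t).mul_const (f1 z)).const_add (g z)
    obtain ⟨L, hL, hL1, hL2⟩ := partials Y t z _ _ (aY t z hzb) d1 d2
    have key : z * (g1 z + A t * f2 z) = n * f1 z * (1 + A t * P z / n) := by
      simp only [hYdef] at hYz
      rw [hP z hzb]
      have := hg1 z hzb
      have e : A t * f1 z = - g z := by linear_combination hYz
      have e2 : A t * (f1 z / g z) = -1 := by field_simp; exact e
      have e3 : n * f1 z * (1 + A t * (1 + z * f2 z / f1 z + (n - 1) * (f1 z / g z)) / n) =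
        f1 z * n + A t * f1 z + A t * z * f2 z + f1 z * (n - 1) * (A t * (f1 z / g z)) := by
        field_simp
        ring
      rw [e3, e2, e]
      linear_combination this
    have hprod : z * (g1 z + A t * f2 z) ≠ 0 := by
      rw [key]; exact mul_ne_zero (mul_ne_zero hn0 hf1z) hX0
    refine ⟨L, hL, ?_, ?_⟩
    · rw [hL1]; exact right_ne_zero_of_mul hprod
    · intro _
      rw [hL1, hL2, key]
      have e : 2 * n * β * Complex.exp (2 * n * t) * f1 z / (n * f1 z * (1 + A t * P z / n)) =
          2 * β * Complex.exp (2 * n * t) / (1 + A t * P z / n) := by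
        rw [show 2 * n * β * Complex.exp (2 * n * t) * f1 z = (n * f1 z) * (2 * β * Complex.exp (2 * n * t)) by ring]
        exact mul_div_mul_left _ _ (mul_ne_zero hn0 hf1z)
      rw [e]; exact hX1
  have hslit : ∀ t : ℝ, 0 ≤ t → t ≤ T → ∀ z : ℂ, ‖z‖ ≤ r * Real.exp (-t) →
      1 + A t * (f1 z / g z) ∈ Complex.slitPlane := by
    intro t ht htT z hz
    have hgz := hg0 z (hball t ht z hz)
    by_contra hns
    rw [Complex.mem_slitPlane_iff_not_le_zero, not_not] at hns
    set v : ℂ := β * (f1 z / g z) with hv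
    set τ : ℝ := Real.exp (2 * n * t) - 1 with hτ
    have hnpos : 0 < n := by linarith
    have hτ0 : 0 ≤ τ := by
      have := Real.one_le_exp (show 0 ≤ 2 * n * t by positivity)
      linarith
    have e1 : 1 + A t * (f1 z / g z) = 1 + τ * v := by
      simp only [hA, hv, hτ]; push_cast; ring
    rw [e1, Complex.le_def] at hns
    obtain ⟨hre, him⟩ := hns
    simp at hre him
    have hτpos : 0 < τ := by
      rcases hτ0.eq_or_lt with h | h
      · rw [← h] at hre; simp at hre; linarith
      · exact h
    have hvim : v.im = 0 := by
      rcases him with h | h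
      · exact absurd h hτpos.ne'
      · exact h
    have hvre : v.re < 0 := by
      by_contra hcon
      push Not at hcon
      nlinarith
    -- the vanishing time
    set τ' : ℝ := -1 / v.re with hτ'
    have hτ'pos : 0 < τ' := by rw [hτ']; exact div_pos_of_neg_of_neg (by norm_num) hvre
    have hτ'le : τ' ≤ τ := by
      rw [hτ', div_le_iff_of_neg hvre]; linarith
    set t' : ℝ := Real.log (1 + τ') / (2 * n) with ht'
    have ht'0 : 0 ≤ t' := div_nonneg (Real.log_nonneg (by linarith)) (by linarith)
    have hE' : Real.exp (2 * n * t') = 1 + τ' := by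
      rw [ht', mul_div_cancel₀ _ (by positivity), Real.exp_log (by linarith)]
    have ht't : t' ≤ t := by
      have : Real.exp (2 * n * t') ≤ Real.exp (2 * n * t) := by rw [hE']; linarith
      have := Real.exp_le_exp.mp this
      exact le_of_mul_le_mul_left this (by positivity)
    have hz' : ‖z‖ ≤ r * Real.exp (-t') := by
      refine hz.trans (mul_le_mul_of_nonneg_left (Real.exp_le_exp.mpr (by linarith)) hr.le)
    apply hYne t' ht'0 (ht't.trans htT) z hz'
    have hAt' : A t' = β * τ' := by
      simp only [hA]
      have : Complex.exp (2 * n * t') = ((1 + τ' : ℝ) : ℂ) := by rw [← hE']; push_cast; rfl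
      rw [this]; push_cast; ring
    have hvv : v = (v.re : ℂ) := Complex.ext (by simp) (by simp [hvim])
    have hτv : (τ' : ℂ) * v = -1 := by
      rw [hvv, ← Complex.ofReal_mul, hτ', div_mul_cancel₀ _ hvre.ne]; simp
    simp only [hYdef, hAt']
    have : f1 z = (f1 z / g z) * g z := by field_simp
    rw [this]
    linear_combination g z * hτv
  have main := inj_slide Θ r T hr hT0 ?_ hΘT
  · intro z w hz hw h
    refine main z w hz hw ?_
    simp [hΘ, hA, h]
  intro t ht htT z hz
  have hzb := hball t ht z hz
  have hf1z := hf10 z hzb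
  have hgz := hg0 z hzb
  have hs := hslit t ht htT z hz
  obtain ⟨hX0, hX1⟩ := hX t ht z hz
  have hs0 : 1 + A t * (f1 z / g z) ≠ 0 := Complex.slitPlane_ne_zero hs
  have aΘ : AnalyticAt ℂ Θ ((t : ℂ), z) := by
    refine (asnd f (_, _) (af z hzb)).mul ?_
    refine (analyticAt_const.mul (AnalyticAt.clog ?_ ?_)).cexp
    · exact analyticAt_const.add ((afst A (_, _) (aA t)).mul (asnd _ (_, _) (ap z hzb)))
    · exact hs
  set e := Complex.exp ((1 / n) * Complex.log (1 + A t * (f1 z / g z))) with he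
  have he0 : e ≠ 0 := Complex.exp_ne_zero _
  have d1 := (df z hzb).mul ((((((df1 z hzb).div (dg z hzb) hgz).const_mul (A t)).const_add 1).clog hs).const_mul (1 / (n : ℂ))).cexp
  have d2 := ((((((dA t).mul_const (f1 z / g z)).const_add 1).clog hs).const_mul (1 / (n : ℂ))).cexp).const_mul (f z)
  obtain ⟨L, hL, hL1, hL2⟩ := partials Θ t z _ _ aΘ d1 d2
  have key : L (0, 1) = e * f1 z * (1 + A t * P z / n) / (1 + A t * (f1 z / g z)) := by
    rw [hL1, eq_div_iff hs0]
    simp only [Pi.div_apply]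
    rw [← he, hP z hzb, hfg z hzb]
    have hh := hg1 z hzb
    have e2 : z * g z * (e * (1 / n * (A t * ((f2 z * g z - f1 z * g1 z) / g z ^ 2) / (1 + A t * (f1 z / g z))))) * (1 + A t * (f1 z / g z))
      = e * A t / n * (z * f2 z - f1 z * (z * g1 z) / g z) := by
      generalize 1 + A t * (f1 z / g z) = S at hs0
      field_simp
    rw [add_mul, e2, hh]
    field_simp
    ring
  have key2 : L (1, 0) = z * (e * f1 z * (2 * β * Complex.exp (2 * n * t))) / (1 + A t * (f1 z / g z)) := by
    rw [hL2, hfg z hzb, ← he]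
    field_simp
  refine ⟨L, hL, ?_, ?_⟩
  · rw [key]
    exact div_ne_zero (mul_ne_zero (mul_ne_zero he0 hf1z) hX0) hs0
  · intro hzr
    have hz0 : z ≠ 0 := by
      rintro rfl
      have := Real.exp_pos (-t)
      rw [norm_zero] at hzr
      nlinarith
    have e3 : L (1, 0) / (z * L (0, 1)) = 2 * β * Complex.exp (2 * n * t) / (1 + A t * P z / n) := by
      rw [key, key2]
      generalize 1 + A t * P z / n = X at hX0
      generalize 1 + A t * (f1 z / g z) = S at hs0
      field_simp
    rw [e3]; exact hX1

open Metric

/-- If `q > 0`, `0 < cos λ < 1/(2 + 4q)` and `Re(e^{−iλ}(1 + zf''/f' + q·zf'/f)) > 0` on 𝔻, then `f` is univalent. -/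
theorem univalence_q_pos (lam : ℝ)
    (hlam : lam ∈ Set.Ioo (-(Real.pi / 2)) (Real.pi / 2))
    (q : ℝ) (hq : 0 < q)
    (hcos : 0 < Real.cos lam) (hcos2 : Real.cos lam < 1 / (2 + 4 * q))
    (f : ℂ → ℂ)
    (hf : DifferentiableOn ℂ f (ball (0 : ℂ) 1))
    (hf0 : f 0 = 0) (hf'0 : deriv f 0 = 1)
    (hf' : ∀ z ∈ ball (0 : ℂ) 1, deriv f z ≠ 0)
    (hfne : ∀ z ∈ ball (0 : ℂ) 1, z ≠ 0 → f z ≠ 0)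
    (hcond : ∀ z ∈ ball (0 : ℂ) 1,
      0 < (Complex.exp (-(lam : ℂ) * Complex.I) *
        (1 + z * deriv (deriv f) z / deriv f z +
          (q : ℂ) * (if z = 0 then 1 else z * deriv f z / f z))).re) :
    Set.InjOn f (ball (0 : ℂ) 1) := by
  have hopen : IsOpen (ball (0 : ℂ) 1) := isOpen_ball
  have h0mem : (0 : ℂ) ∈ ball (0 : ℂ) 1 := by simp
  set g : ℂ → ℂ := dslope f 0 with hg
  have hgd : DifferentiableOn ℂ g (ball (0 : ℂ) 1) :=
    (Complex.differentiableOn_dslope (hopen.mem_nhds h0mem)).mpr hf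
  have hfg : ∀ z, f z = z * g z := by
    intro z
    have := sub_smul_dslope f 0 z
    simp [hf0] at this
    exact this.symm
  have g_zero : g 0 = 1 := by rw [hg, dslope_same, hf'0]
  have hg0 : ∀ z ∈ ball (0 : ℂ) 1, g z ≠ 0 := by
    intro z hz h
    by_cases hz0 : z = 0
    · rw [hz0, g_zero] at h; exact one_ne_zero h
    · apply hfne z hz hz0; rw [hfg, h, mul_zero]
  have hf1d : DifferentiableOn ℂ (deriv f) (ball (0 : ℂ) 1) := hf.deriv hopen
  have hf2d : DifferentiableOn ℂ (deriv (deriv f)) (ball (0 : ℂ) 1) := hf1d.deriv hopen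
  have an : ∀ F : ℂ → ℂ, DifferentiableOn ℂ F (ball (0 : ℂ) 1) → ∀ z ∈ ball (0 : ℂ) 1, AnalyticAt ℂ F z :=
    fun F hF z hz => hF.analyticAt (hopen.mem_nhds hz)
  have dr : ∀ F : ℂ → ℂ, DifferentiableOn ℂ F (ball (0 : ℂ) 1) → ∀ z ∈ ball (0 : ℂ) 1, HasDerivAt F (deriv F z) z :=
    fun F hF z hz => (hF.differentiableAt (hopen.mem_nhds hz)).hasDerivAt
  have hg1 : ∀ z ∈ ball (0 : ℂ) 1, z * deriv g z = deriv f z - g z := by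
    intro z hz
    have h1 := (hasDerivAt_id z).mul (dr g hgd z hz)
    have h2 : HasDerivAt f (1 * g z + z * deriv g z) z := by
      refine h1.congr_of_eventuallyEq (Eventually.of_forall fun x => ?_)
      exact hfg x
    rw [h2.deriv]; ring
  set n : ℝ := 1 + q with hn
  have hn1 : 1 ≤ n := by linarith
  set P : ℂ → ℂ := fun z => 1 + z * deriv (deriv f) z / deriv f z + ((n : ℂ) - 1) * (deriv f z / g z) with hP
  have hPd : DifferentiableOn ℂ P (ball (0 : ℂ) 1) := by
    refine DifferentiableOn.add (DifferentiableOn.const_add 1 ?_) (DifferentiableOn.const_mul ?_ _)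
    · exact (differentiableOn_id.mul hf2d).div hf1d hf'
    · exact hf1d.div hgd hg0
  have hP0 : P 0 = n := by simp [hP, g_zero, hf'0]
  have hre : ∀ z ∈ ball (0 : ℂ) 1, 0 < (Complex.exp (-(lam : ℂ) * Complex.I) * P z).re := by
    intro z hz
    have h1 := hcond z hz
    have h2 : (if z = 0 then 1 else z * deriv f z / f z) = deriv f z / g z := by
      split_ifs with h
      · rw [h, g_zero, hf'0]; simp
      · rw [hfg z, mul_div_mul_left _ _ h]
    rw [h2] at h1
    have h3 : ((n : ℂ) - 1) = q := by rw [hn]; push_cast; ring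
    simp only [hP, h3]
    exact h1
  have hsub := subord lam n hn1 hcos P hPd hP0 hre
  set ε : ℂ := Complex.exp (lam * Complex.I) * Real.cos lam with hεdef
  have hεn : ‖ε‖ = Real.cos lam := by
    rw [hεdef, norm_mul, Complex.norm_exp_ofReal_mul_I, one_mul, Complex.norm_real, Real.norm_of_nonneg hcos.le]
  have hε : 2 * ‖ε‖ * (2 * n - 1) < 1 := by
    rw [hεn, hn]
    rw [lt_div_iff₀ (by linarith)] at hcos2
    linarith
  have hne : (1 - 2 * (n : ℂ) * ε) ≠ 0 := by
    intro h
    have h1 : 2 * (n : ℂ) * ε = 1 := by linear_combination -h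
    have h2 := congrArg norm h1
    rw [norm_mul, norm_mul, Complex.norm_real, Real.norm_of_nonneg (by linarith)] at h2
    simp only [Complex.norm_ofNat, norm_one] at h2
    nlinarith [norm_nonneg ε]
  intro z hz w hw hzw
  rw [mem_ball_zero_iff] at hz hw
  refine core n (max (max ‖z‖ ‖w‖) (1 / 2)) hn1 (lt_max_of_lt_right (by norm_num))
    (max_lt (max_lt hz hw) (by norm_num)) ε (1 - 2 * (n : ℂ) * ε)⁻¹ hε (inv_mul_cancel₀ hne)
    f (deriv f) (deriv (deriv f)) g (deriv g) P (an f hf) (an _ hf1d) (an g hgd)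
    (dr f hf) (dr _ hf1d) (dr g hgd) (fun z _ => hfg z) hg1 hg0 hf' g_zero hf'0 (fun z _ => rfl) hsub
    z w ?_ ?_ hzw
  · exact (le_max_left _ _).trans (le_max_left _ _)
  · exact (le_max_right _ _).trans (le_max_left _ _)
end

section
/- Let λ ∈ (−π/2, π/2) with 0 < cos λ < 1, let q ∈ (−1, 0], and let f be analytic on the unit disk 𝔻 with f(0) = 0, f'(0) = 1, f''(0) = 0, f'(z) ≠ 0 on 𝔻 and f(z) ≠ 0 for z ≠ 0. If Re(e^{−iλ}(1 + z f''(z)/f'(z) + q · z f'(z)/f(z))) > 0 for all z ∈ 𝔻 (where z f'(z)/f(z) is interpreted as 1 at z = 0), then f is univalent (injective) on 𝔻. -/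
open Metric

lemma aux_schwarz2 (w : ℂ → ℂ) (hd : DifferentiableOn ℂ w (ball 0 1))
    (hm : ∀ z ∈ ball (0:ℂ) 1, ‖w z‖ ≤ 1) (h0 : w 0 = 0) (h1 : deriv w 0 = 0)
    (z : ℂ) (hz : z ∈ ball (0:ℂ) 1) : ‖w z‖ ≤ ‖z‖ ^ 2 := by
  have hda : DifferentiableAt ℂ w 0 := hd.differentiableAt (isOpen_ball.mem_nhds (by simp))
  have h := Complex.dist_le_mul_div_pow_of_mapsTo_ball_of_isLittleO (f := w) (c := 0) (z := z)
    (R₁ := 1) (R₂ := 1) (n := 1) hd (fun x hx => by simpa [h0] using hm x hx) ?_ hz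
  · simpa [h0] using h
  · have := hda.hasDerivAt.isLittleO
    simp only [h1, h0, smul_zero, sub_zero] at this
    simpa [h0] using this.norm_right

lemma aux_alg (x : ℝ) (hx0 : 0 ≤ x) (hx1 : x ≤ 1) (w : ℂ) (hw : ‖w‖ ≤ x) (hw1 : ‖w‖ < 1) :
    ‖-(x:ℂ) + (1 - x) * (2 * (w / (1 - w)))‖ ≤ 1 := by
  have hne : (1:ℂ) - w ≠ 0 := by
    intro h
    have : w = 1 := (sub_eq_zero.mp h).symm
    rw [this] at hw1; simp at hw1
  have e : -(x:ℂ) + (1 - x) * (2 * (w / (1 - w))) = ((2 - x) * w - x) / (1 - w) := by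
    field_simp; ring
  rw [e, norm_div, div_le_one (norm_pos_iff.mpr hne)]
  rw [← sq_le_sq₀ (norm_nonneg _) (norm_nonneg _), ← Complex.normSq_eq_norm_sq,
    ← Complex.normSq_eq_norm_sq]
  have h1 : w.re ^ 2 + w.im ^ 2 ≤ x ^ 2 := by
    have : ‖w‖ ^ 2 ≤ x ^ 2 := by gcongr
    rw [← Complex.normSq_eq_norm_sq, Complex.normSq_apply] at this
    nlinarith
  have h2 : w.re ≤ x := (Complex.re_le_norm w).trans hw
  simp only [Complex.normSq_apply, Complex.sub_re, Complex.sub_im, Complex.mul_re, Complex.mul_im,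
    Complex.ofReal_re, Complex.ofReal_im, Complex.one_re, Complex.one_im, Complex.re_ofNat,
    Complex.im_ofNat]
  have k1 : (1-x)*(3-x)*(w.re ^ 2 + w.im ^ 2) ≤ (1-x)*(3-x)*x^2 :=
    mul_le_mul_of_nonneg_left h1 (mul_nonneg (by linarith) (by linarith))
  have k2 : (1-x)^2 * w.re ≤ (1-x)^2 * x := mul_le_mul_of_nonneg_left h2 (by positivity)
  have k3 : 0 ≤ (1-x)^3*(1+x) := mul_nonneg (pow_nonneg (by linarith) _) (by linarith)
  nlinarith

lemma aux_proj (ρ : ℝ) (hρ : 0 < ρ) : ∃ p : ℂ → ℂ, LipschitzWith 2 p ∧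
    (∀ z, ‖p z‖ ≤ ρ) ∧ (∀ z, ‖z‖ ≤ ρ → p z = z) ∧ (∀ z, ∃ m : ℝ, 0 ≤ m ∧ p z = m * z) := by
  refine ⟨fun z => ((max 1 (‖z‖/ρ))⁻¹ : ℝ) * z, ?_, ?_, ?_, fun z => ⟨(max 1 (‖z‖/ρ))⁻¹, by positivity, rfl⟩⟩
  · apply LipschitzWith.of_dist_le_mul
    intro x y
    rw [dist_eq_norm, dist_eq_norm]
    set a := max 1 (‖x‖/ρ) with ha
    set b := max 1 (‖y‖/ρ) with hb
    have ha1 : 1 ≤ a := le_max_left _ _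
    have hb1 : 1 ≤ b := le_max_left _ _
    have hy : ‖y‖ ≤ b * ρ := by
      rw [← div_le_iff₀ hρ]; exact le_max_right _ _
    have hab : |b - a| ≤ ‖x - y‖ / ρ := by
      have h := abs_max_sub_max_le_abs (‖y‖/ρ) (‖x‖/ρ) 1
      rw [max_comm _ 1, max_comm _ 1] at h
      refine h.trans ?_
      rw [← sub_div, abs_div, abs_of_pos hρ]
      gcongr
      rw [abs_sub_comm]
      exact abs_norm_sub_norm_le x y
    have e : ((a⁻¹ : ℝ):ℂ) * x - ((b⁻¹:ℝ):ℂ) * y = ((a⁻¹ : ℝ):ℂ) * (x - y) + (((b - a) / (a*b) : ℝ):ℂ) * y := by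
      have : (a:ℂ) ≠ 0 := by exact_mod_cast (by positivity : a ≠ 0)
      have : (b:ℂ) ≠ 0 := by exact_mod_cast (by positivity : b ≠ 0)
      push_cast
      field_simp
      ring
    rw [e]
    refine (norm_add_le _ _).trans ?_
    rw [norm_mul, norm_mul, Complex.norm_real, Complex.norm_real, Real.norm_eq_abs, Real.norm_eq_abs,
      abs_of_pos (by positivity : 0 < a⁻¹), abs_div, abs_of_pos (by positivity : 0 < a * b)]
    have h1 : a⁻¹ * ‖x - y‖ ≤ ‖x-y‖ := by
      have : a⁻¹ ≤ 1 := inv_le_one_of_one_le₀ ha1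
      exact mul_le_of_le_one_left (norm_nonneg _) this
    have h2 : |b - a| / (a * b) * ‖y‖ ≤ ‖x - y‖ := by
      calc |b - a| / (a * b) * ‖y‖ ≤ (‖x - y‖ / ρ) / (1 * b) * (b * ρ) := by gcongr
        _ = ‖x - y‖ := by field_simp
    simp only [NNReal.coe_ofNat]
    linarith
  · intro z
    rw [norm_mul, Complex.norm_real, Real.norm_eq_abs, abs_of_pos (by positivity), inv_mul_le_iff₀ (by positivity), ← div_le_iff₀ hρ]
    exact le_max_right _ _
  · intro z hz
    have : max 1 (‖z‖/ρ) = 1 := max_eq_left (by rw [div_le_one hρ]; exact hz)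
    simp [this]

lemma aux_lip (g : ℂ → ℂ) (B ρ : ℝ) (hρ : ρ < 1) (hd : DifferentiableOn ℂ g (ball 0 1))
    (hB : ∀ z ∈ ball (0:ℂ) 1, ‖g z‖ ≤ B) :
    LipschitzOnWith (Real.toNNReal (B / ((1 - ρ)/2))) g (closedBall 0 ρ) := by
  apply (convex_closedBall (0:ℂ) ρ).lipschitzOnWith_of_nnnorm_deriv_le (𝕜 := ℂ)
  · intro x hx
    refine hd.differentiableAt (isOpen_ball.mem_nhds ?_)
    simp at hx ⊢; linarith
  · intro x hx
    rw [← NNReal.coe_le_coe, coe_nnnorm]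
    refine le_trans ?_ (Real.le_coe_toNNReal _)
    have hx' : ‖x‖ ≤ ρ := by simpa using hx
    have hsub : closedBall x ((1-ρ)/2) ⊆ ball 0 1 := by
      intro y hy
      have hy' : ‖y - x‖ ≤ (1-ρ)/2 := by simpa [dist_eq_norm] using hy
      have : ‖y‖ ≤ ‖y - x‖ + ‖x‖ := by simpa using norm_add_le (y - x) x
      simp; linarith
    refine Complex.norm_deriv_le_of_forall_mem_sphere_norm_le (by linarith) ?_ ?_
    · exact (hd.mono (closure_ball_subset_closedBall.trans hsub)).diffContOnCl
    · exact fun z hz => hB z (hsub (sphere_subset_closedBall hz))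

lemma aux_flow (g : ℝ → ℂ → ℂ) (B T ρ : ℝ) (hT : 0 < T) (hρ0 : 0 < ρ) (hρ : ρ < 1)
    (hd : ∀ t ∈ Set.Icc 0 T, DifferentiableOn ℂ (g t) (ball 0 1))
    (hB : ∀ t ∈ Set.Icc 0 T, ∀ z ∈ ball (0:ℂ) 1, ‖g t z‖ ≤ B)
    (hre : ∀ t ∈ Set.Icc 0 T, ∀ z ∈ ball (0:ℂ) 1, (g t z).re ≤ 0)
    (hc : ∀ z ∈ ball (0:ℂ) 1, ContinuousOn (fun t => g t z) (Set.Icc 0 T)) :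
    ∃ Φ : ℂ → ℝ → ℂ, (∀ x ∈ closedBall (0:ℂ) ρ, Φ x 0 = x ∧ ∀ t ∈ Set.Icc 0 T,
      HasDerivWithinAt (Φ x) (Φ x t * g t (Φ x t)) (Set.Icc 0 T) t ∧ ‖Φ x t‖ ≤ ‖x‖) ∧
      ContinuousOn (fun x => Φ x T) (closedBall 0 ρ) ∧
      Set.InjOn (fun x => Φ x T) (closedBall 0 ρ) := by
  obtain ⟨p, hpl, hpn, hpe, hpm⟩ := aux_proj ρ hρ0
  have hpb : ∀ z, p z ∈ ball (0:ℂ) 1 := fun z => by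
    have := hpn z
    simp; linarith
  have hB0 : 0 ≤ B := (norm_nonneg _).trans (hB 0 ⟨le_rfl, hT.le⟩ 0 (by simp))
  set v : ℝ → ℂ → ℂ := fun t z => p z * g t (p z) with hv
  set K : NNReal := Real.toNNReal (B / ((1 - ρ)/2)) * 2 with hK
  have hvl : ∀ t ∈ Set.Icc 0 T, LipschitzWith K (v t) := by
    intro t ht
    have h1 := aux_lip (fun z => z * g t z) B ρ hρ (differentiableOn_id.mul (hd t ht)) (by
      intro z hz
      rw [norm_mul]
      have : ‖z‖ ≤ 1 := by simp at hz; exact hz.le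
      calc ‖z‖ * ‖g t z‖ ≤ 1 * B := by gcongr; exact hB t ht z hz
        _ = B := one_mul _)
    have := h1.comp (hpl.lipschitzOnWith (s := Set.univ)) (fun z _ => by simpa using hpn z)
    rwa [lipschitzOnWith_univ] at this
  have hvn : ∀ t ∈ Set.Icc 0 T, ∀ z, ‖v t z‖ ≤ B := by
    intro t ht z
    simp only [hv, norm_mul]
    calc ‖p z‖ * ‖g t (p z)‖ ≤ 1 * B := by
          gcongr
          · exact (hpn z).trans hρ.le
          · exact hB t ht _ (hpb z)
      _ = B := one_mul _
  have hPL : IsPicardLindelof v (tmin := 0) (tmax := T) ⟨0, le_rfl, hT.le⟩ 0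
      (Real.toNNReal (B * T + ρ)) (Real.toNNReal ρ) (Real.toNNReal B) K := by
    refine ⟨fun t ht => (hvl t ht).lipschitzOnWith, ?_, ?_, ?_⟩
    · intro x _
      exact continuousOn_const.mul (hc _ (hpb x))
    · intro t ht x _
      exact (hvn t ht x).trans (Real.le_coe_toNNReal _)
    · rw [Real.coe_toNNReal _ hB0, Real.coe_toNNReal _ hρ0.le, Real.coe_toNNReal _ (by positivity)]
      simp [hT.le]
  obtain ⟨Φ, hΦ, L', hL'⟩ := hPL.exists_forall_mem_closedBall_eq_hasDerivWithinAt_lipschitzOnWith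
  rw [Real.coe_toNNReal _ hρ0.le] at hΦ hL'
  simp only at hΦ
  have hdec : ∀ x ∈ closedBall (0:ℂ) ρ, ∀ t ∈ Set.Icc 0 T, ‖Φ x t‖ ≤ ‖x‖ := by
    intro x hx t ht
    obtain ⟨h0, h1⟩ := hΦ x hx
    have hanti : AntitoneOn (fun t => ‖Φ x t‖ ^ 2) (Set.Icc 0 T) := by
      refine antitoneOn_of_hasDerivWithinAt_nonpos (convex_Icc 0 T)
        (f' := fun t => 2 * inner ℝ (Φ x t) (v t (Φ x t))) ?_ ?_ ?_
      · exact fun s hs => ((h1 s hs).continuousWithinAt.norm.pow 2)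
      · intro s hs
        exact ((h1 s (interior_subset hs)).norm_sq).mono interior_subset
      · intro s hs
        have hs' := interior_subset hs
        obtain ⟨m, hm, hpm⟩ := hpm (Φ x s)
        have hr := hre s hs' _ (hpb (Φ x s))
        have : inner ℝ (Φ x s) (v s (Φ x s)) = m * Complex.normSq (Φ x s) * (g s (p (Φ x s))).re := by
          rw [Complex.inner]
          simp only [hv]
          generalize g s (p (Φ x s)) = G
          rw [hpm]
          simp [Complex.normSq_apply]
          ring
        rw [this]
        have : 0 ≤ m * Complex.normSq (Φ x s) := mul_nonneg hm (Complex.normSq_nonneg _)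
        nlinarith
    have := hanti ⟨le_rfl, hT.le⟩ ht ht.1
    simp only [h0] at this
    exact (sq_le_sq₀ (norm_nonneg _) (norm_nonneg _)).mp this
  refine ⟨Φ, ?_, ?_, ?_⟩
  · intro x hx
    refine ⟨(hΦ x hx).1, fun t ht => ⟨?_, hdec x hx t ht⟩⟩
    have := (hΦ x hx).2 t ht
    simp only [hv] at this
    rwa [hpe _ ((hdec x hx t ht).trans (by simpa using hx))] at this
  · exact (hL' T ⟨hT.le, le_rfl⟩).continuousOn
  · intro x hx y hy hxy
    have := ODE_solution_unique_of_mem_Icc_left (v := v) (s := fun _ => Set.univ) (K := K)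
      (f := Φ x) (g := Φ y) (a := 0) (b := T)
      (fun t ht => (hvl t ⟨ht.1.le, ht.2⟩).lipschitzOnWith)
      (fun s hs => ((hΦ x hx).2 s hs).continuousWithinAt)
      (fun t ht => ((hΦ x hx).2 t ⟨ht.1.le, ht.2⟩).mono_of_mem_nhdsWithin
        (Filter.mem_of_superset (Icc_mem_nhdsLE ht.1) (Set.Icc_subset_Icc le_rfl ht.2)))
      (fun _ _ => trivial)
      (fun s hs => ((hΦ y hy).2 s hs).continuousWithinAt)
      (fun t ht => ((hΦ y hy).2 t ⟨ht.1.le, ht.2⟩).mono_of_mem_nhdsWithin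
        (Filter.mem_of_superset (Icc_mem_nhdsLE ht.1) (Set.Icc_subset_Icc le_rfl ht.2)))
      (fun _ _ => trivial) hxy
    have := this ⟨le_rfl, hT.le⟩
    rwa [(hΦ x hx).1, (hΦ y hy).1] at this

lemma aux_localinj (f P : ℂ → ℂ) (a : ℂ) (hf : AnalyticAt ℂ f 0) (hP : AnalyticAt ℂ P 0)
    (hf0 : f 0 = 0) (hf1 : deriv f 0 = 1) (hP0 : P 0 = 1) :
    ∃ δ > 0, ∀ h : ℂ, ‖h‖ < δ → (∀ z ∈ ball (0:ℂ) δ, P z + h ∈ Complex.slitPlane) ∧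
      Set.InjOn (fun z => f z * Complex.exp (a * Complex.log (P z + h))) (ball 0 δ) := by
  have hP2 : AnalyticAt ℂ (fun p : ℂ × ℂ => P p.2 + p.1) (0, 0) :=
    (AnalyticAt.fun_comp (f := fun p : ℂ × ℂ => p.2) (x := (0,0)) hP analyticAt_snd).add analyticAt_fst
  have hf2 : AnalyticAt ℂ (fun p : ℂ × ℂ => f p.2) (0, 0) :=
    (AnalyticAt.fun_comp (f := fun p : ℂ × ℂ => p.2) (x := (0,0)) hf analyticAt_snd)
  have hE : AnalyticAt ℂ (fun p : ℂ × ℂ => Complex.exp (a * Complex.log (P p.2 + p.1))) (0, 0) := by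
    refine AnalyticAt.cexp (analyticAt_const.mul (AnalyticAt.clog hP2 ?_))
    simp [hP0]
  have hfs : HasStrictFDerivAt (fun p : ℂ × ℂ => f p.2)
      (((ContinuousLinearMap.toSpanSingleton ℂ (1:ℂ))).comp (ContinuousLinearMap.snd ℂ ℂ ℂ)) (0,0) := by
    have h1 : HasStrictDerivAt f (1:ℂ) ((0:ℂ),(0:ℂ)).2 := by
      have := hf.hasStrictDerivAt
      rwa [hf1] at this
    exact h1.hasStrictFDerivAt.comp ((0:ℂ),(0:ℂ)) hasStrictFDerivAt_snd
  have hG := hfs.mul hE.hasStrictFDerivAt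
  have ho := hG.isLittleO.def (c := 1/2) (by norm_num)
  have hsl : ∀ᶠ p : ℂ × ℂ in nhds (0,0), P p.2 + p.1 ∈ Complex.slitPlane :=
    hP2.continuousAt.eventually (Complex.isOpen_slitPlane.mem_nhds (by simp [hP0]))
  obtain ⟨δ1, hδ1, h1⟩ := Metric.eventually_nhds_iff_ball.mp ho
  obtain ⟨δ2, hδ2, h2⟩ := Metric.eventually_nhds_iff_ball.mp hsl
  refine ⟨min δ1 δ2, lt_min hδ1 hδ2, fun h hh => ⟨fun z hz => ?_, fun z hz w hw hzw => ?_⟩⟩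
  · refine h2 (h, z) ?_
    simp [Prod.dist_eq] at hz ⊢
    exact ⟨hh.trans_le (min_le_right _ _), hz.2⟩
  · have := h1 ((h, z), (h, w)) (by
      simp [Prod.dist_eq] at hz hw ⊢
      have := hh.trans_le (min_le_left _ _)
      exact ⟨⟨this, hz.1⟩, ⟨this, hw.1⟩⟩)
    simp only at hzw
    simp [hzw, hf0, hP0, Prod.norm_def] at this
    by_contra hne
    have h3 : 0 < ‖z - w‖ := norm_pos_iff.mpr (sub_ne_zero.mpr hne)
    rw [norm_sub_rev w z] at this
    linarith

lemma aux_cons (f P Q D P' : ℂ → ℂ) (α b : ℂ) (T : ℝ) (hT : 0 < T) (ζ s : ℝ → ℂ)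
    (hζ : ∀ t ∈ Set.Icc 0 T, HasDerivWithinAt ζ (-(2 * ζ t / (1 + s t))) (Set.Icc 0 T) t)
    (hs : ContinuousOn s (Set.Icc 0 T)) (hs1 : ∀ t ∈ Set.Icc 0 T, 1 + s t ≠ 0)
    (hb : ∀ t ∈ Set.Icc 0 T, b * Complex.exp (2 * t) * (1 + s t) =
      α + b * (Complex.exp (2 * t) - 1) * Q (ζ t))
    (hf : ∀ t ∈ Set.Icc 0 T, HasDerivAt f (D (ζ t)) (ζ t))
    (hD : ∀ t ∈ Set.Icc 0 T, ζ t * D (ζ t) = f (ζ t) * P (ζ t))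
    (hP : ∀ t ∈ Set.Icc 0 T, HasDerivAt P (P' (ζ t)) (ζ t))
    (hP' : ∀ t ∈ Set.Icc 0 T, ζ t * P' (ζ t) = P (ζ t) * Q (ζ t) - α * P (ζ t) ^ 2) :
    ∃ A : ℂ, f (ζ 0) = f (ζ T) * Complex.exp A ∧
      Complex.exp (α * A) = 1 + b * (Complex.exp (2 * T) - 1) * P (ζ T) := by
  set u : ℝ → ℂ := fun t => 2 * P (ζ t) / (1 + s t) with hu
  have hζc : ContinuousOn ζ (Set.Icc 0 T) := fun t ht => (hζ t ht).continuousWithinAt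
  have hPc : ContinuousOn (fun t => P (ζ t)) (Set.Icc 0 T) := fun t ht =>
    (hP t ht).continuousAt.comp_continuousWithinAt (hζc t ht)
  have huc : ContinuousOn u (Set.Icc 0 T) :=
    (continuousOn_const.mul hPc).div (continuousOn_const.add hs) hs1
  set U : ℝ → ℂ := Set.IccExtend hT.le ((Set.Icc 0 T).domRestrict u) with hU
  have hUc : Continuous U := huc.domRestrict.Icc_extend'
  have hUe : ∀ t ∈ Set.Icc 0 T, U t = u t := fun t ht => by
    rw [hU, Set.IccExtend_of_mem _ _ ht]; rfl
  set A : ℝ → ℂ := fun t => ∫ τ in (0:ℝ)..t, U τ with hA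
  have hAd : ∀ t, HasDerivAt A (U t) t := fun t => hUc.integral_hasStrictDerivAt 0 t |>.hasDerivAt
  have hexp : ∀ t : ℝ, HasDerivAt (fun t : ℝ => Complex.exp (2 * t)) (2 * Complex.exp (2 * t)) t := by
    intro t
    have h1 : HasDerivAt (fun t : ℝ => (2:ℂ) * (t:ℂ)) (2 * 1) t :=
      (Complex.ofRealCLM.hasDerivAt).const_mul 2
    have := h1.cexp
    simpa [mul_comm] using this
  have key : ∀ F : ℝ → ℂ, (∀ t ∈ Set.Icc 0 T, HasDerivWithinAt F 0 (Set.Icc 0 T) t) → F T = F 0 := by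
    intro F hF
    refine constant_of_has_deriv_right_zero (fun t ht => (hF t ht).continuousWithinAt) ?_ T ⟨hT.le, le_rfl⟩
    intro t ht
    exact (hF t ⟨ht.1, ht.2.le⟩).mono_of_mem_nhdsWithin
      (Filter.mem_of_superset (Icc_mem_nhdsGE ht.2) (Set.Icc_subset_Icc ht.1 le_rfl))
  have hA0 : A 0 = 0 := by simp [hA]
  refine ⟨A T, ?_, ?_⟩
  · have := key (fun t => f (ζ t) * Complex.exp (A t)) (fun t ht => by
      have h1 := (((hf t ht).comp_hasDerivWithinAt t (hζ t ht)).mul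
        ((hAd t).cexp.hasDerivWithinAt (s := Set.Icc 0 T)))
      refine h1.congr_deriv ?_
      rw [hUe t ht]
      simp only [hu, Function.comp]
      have e := hD t ht
      have e1 := hs1 t ht
      field_simp
      linear_combination (-2 * Complex.exp (A t)) * e)
    simp only [hA0, Complex.exp_zero, mul_one] at this
    exact this.symm
  · have := key (fun t => (1 + b * (Complex.exp (2 * t) - 1) * P (ζ t)) * Complex.exp (-(α * A t))) (fun t ht => by
      have h0 := ((((hexp t).sub_const 1).const_mul b).hasDerivWithinAt (s := Set.Icc 0 T)).mul
        ((hP t ht).comp_hasDerivWithinAt t (hζ t ht))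
      have h1 := (h0.const_add 1).mul
        (((hAd t).const_mul α).neg.cexp.hasDerivWithinAt (s := Set.Icc 0 T))
      refine h1.congr_deriv ?_
      rw [hUe t ht]
      simp only [hu, Function.comp]
      have e := hP' t ht
      have e2 := hb t ht
      have e1 := hs1 t ht
      simp only [Pi.mul_apply, Pi.neg_apply, Function.comp]
      field_simp
      linear_combination (Complex.exp (-(α * A t))) * ((2 * P (ζ t)) * e2 - (2 * b * (Complex.exp (2 * t) - 1)) * e))
    simp only [hA0, mul_zero, neg_zero, Complex.exp_zero, mul_one, Complex.ofReal_zero, sub_self, zero_mul, add_zero] at this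
    rw [Complex.exp_neg] at this
    have e := Complex.exp_ne_zero (α * A T)
    field_simp at this
    exact this.symm

lemma aux_conn (ρ : ℝ) : IsPreconnected (ball (0:ℂ) ρ \ {0}) := by
  have : ball (0:ℂ) ρ \ {0} = (fun p : ℝ × ℝ => (p.1:ℂ) * Complex.exp (p.2 * Complex.I)) '' (Set.Ioo 0 ρ ×ˢ Set.univ) := by
    ext z
    simp only [Set.mem_sdiff, mem_ball_zero_iff, Set.mem_singleton_iff, Set.mem_image, Set.mem_prod, Set.mem_Ioo, Set.mem_univ, and_true, Prod.exists]
    constructor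
    · rintro ⟨h1, h2⟩
      exact ⟨‖z‖, z.arg, ⟨norm_pos_iff.mpr h2, h1⟩, Complex.norm_mul_exp_arg_mul_I z⟩
    · rintro ⟨r, θ, ⟨h1, h2⟩, rfl⟩
      refine ⟨?_, ?_⟩
      · rw [norm_mul, Complex.norm_exp_ofReal_mul_I, Complex.norm_real, Real.norm_eq_abs, abs_of_pos h1]; simpa
      · exact mul_ne_zero (by exact_mod_cast h1.ne') (Complex.exp_ne_zero _)
  rw [this]
  exact (isPreconnected_Ioo.prod isPreconnected_univ).image _ (by fun_prop)

lemma aux_count (α h : ℂ) (hα : α ≠ 0) (hh : h ≠ 0) :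
    {y : ℂ | ∃ X, y = Complex.exp X ∧ Complex.exp (α * X) = h}.Countable := by
  refine (Set.countable_range (fun n : ℤ => Complex.exp ((Complex.log h + n * (2 * Real.pi * Complex.I)) / α))).mono ?_
  rintro y ⟨X, rfl, hX⟩
  rw [← Complex.exp_log hh, Complex.exp_eq_exp_iff_exists_int] at hX
  obtain ⟨n, hn⟩ := hX
  refine ⟨n, ?_⟩
  simp only
  rw [← hn, mul_div_cancel_left₀ _ hα]

lemma aux_Q (lam α : ℝ) (hcos : 0 < Real.cos lam) (hα : 0 < α) (hα1 : α ≤ 1)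
    (Q : ℂ → ℂ) (hd : DifferentiableOn ℂ Q (ball 0 1)) (hQ0 : Q 0 = α) (hQ1 : deriv Q 0 = 0)
    (hre : ∀ z ∈ ball (0:ℂ) 1, 0 < (Complex.exp (-(lam : ℂ) * Complex.I) * Q z).re)
    (x : ℝ) (hx1 : x ≤ 1) (z : ℂ) (hz : z ∈ ball (0:ℂ) 1) (hzx : ‖z‖ ^ 2 ≤ x) :
    ‖((α:ℂ) - 1) - x * α * (Real.cos lam * Complex.exp (lam * Complex.I)) + (1 - x) * (Q z - α)‖
      ≤ 1 - α + α * Real.cos lam := by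
  set E := Complex.exp (lam * Complex.I) with hE
  have hEn : ‖E‖ = 1 := Complex.norm_exp_ofReal_mul_I lam
  have hE0 : E ≠ 0 := Complex.exp_ne_zero _
  have hEi : Complex.exp (-(lam : ℂ) * Complex.I) = E⁻¹ := by rw [hE, ← Complex.exp_neg]; ring_nf
  have hEre : E.re = Real.cos lam := Complex.exp_ofReal_mul_I_re lam
  have hEim : E.im = Real.sin lam := Complex.exp_ofReal_mul_I_im lam
  have hEconj : E⁻¹ = (starRingEnd ℂ) E := by
    rw [Complex.inv_def, Complex.normSq_eq_norm_sq, hEn]; simp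
  have h2C : 2 * ((Real.cos lam : ℂ) * E) = 1 + E ^ 2 := by
    have : (2:ℂ) * (Real.cos lam : ℂ) = E + E⁻¹ := by
      rw [hEconj, Complex.add_conj, hEre]; push_cast; ring
    rw [← mul_assoc, this]; field_simp; ring
  have hC0 : (Real.cos lam : ℂ) * E ≠ 0 := mul_ne_zero (by exact_mod_cast hcos.ne') hE0
  have hα0 : (α:ℂ) ≠ 0 := by exact_mod_cast hα.ne'
  set Y : ℂ → ℂ := fun z => E⁻¹ * Q z with hY
  have hQY : ∀ z, Q z = E * Y z := fun z => by simp [hY, hE0]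
  have hYre : ∀ z ∈ ball (0:ℂ) 1, 0 < (Y z).re := fun z hz => by
    have := hre z hz; rwa [hEi] at this
  have hden : ∀ z ∈ ball (0:ℂ) 1, Q z + α * E ^ 2 ≠ 0 := by
    intro z hz h
    have h1 : E * (Y z + α * E) = 0 := by rw [← h, hQY]; ring
    have h2 : Y z + α * E = 0 := (mul_eq_zero.mp h1).resolve_left hE0
    have h3 := congrArg Complex.re h2
    simp [hEre] at h3
    have := hYre z hz
    have : 0 < α * Real.cos lam := by positivity
    linarith
  set w : ℂ → ℂ := fun z => (Q z - α) / (Q z + α * E ^ 2) with hw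
  have hwd : DifferentiableOn ℂ w (ball 0 1) :=
    (hd.sub_const _).div (hd.add_const _) hden
  have hw1 : ∀ z ∈ ball (0:ℂ) 1, ‖w z‖ ≤ 1 := by
    intro z hz
    rw [hw]; simp only [norm_div]
    rw [div_le_one (norm_pos_iff.mpr (hden z hz))]
    have e1 : Q z - α = E * (Y z - α * (starRingEnd ℂ) E) := by
      rw [hQY, ← hEconj]; field_simp
    have e2 : Q z + α * E ^ 2 = E * (Y z + α * E) := by rw [hQY]; ring
    rw [e1, e2, norm_mul, norm_mul, hEn, one_mul, one_mul,
      ← sq_le_sq₀ (norm_nonneg _) (norm_nonneg _), ← Complex.normSq_eq_norm_sq,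
      ← Complex.normSq_eq_norm_sq]
    simp [Complex.normSq_apply, hEre, hEim]
    have := mul_pos (hYre z hz) (mul_pos hα hcos)
    nlinarith
  have hQd0 : HasDerivAt Q 0 0 := by
    have := (hd.differentiableAt (isOpen_ball.mem_nhds (by simp : (0:ℂ) ∈ ball (0:ℂ) 1))).hasDerivAt
    rwa [hQ1] at this
  have hwd0 : deriv w 0 = 0 := by
    have := ((hQd0.sub_const (α:ℂ)).div (hQd0.add_const (α * E ^ 2)) (hden 0 (by simp))).deriv
    have e : w = ((fun x => Q x - (α:ℂ)) / fun x => Q x + α * E ^ 2) := rfl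
    rw [e]
    simpa using this
  have hwz := aux_schwarz2 w hwd hw1 (by simp [hw, hQ0]) hwd0 z hz
  have hz1 : ‖z‖ < 1 := by simpa using hz
  have hwz1 : ‖w z‖ < 1 := hwz.trans_lt (by nlinarith [norm_nonneg z])
  have hm := aux_alg x ((sq_nonneg _).trans hzx) hx1 (w z) (hwz.trans hzx) hwz1
  have hrel : Q z - α = α * ((Real.cos lam : ℂ) * E) * (2 * (w z / (1 - w z))) := by
    have hd := hden z hz
    have h1 : 1 - w z = (2 * α * ((Real.cos lam : ℂ) * E)) / (Q z + α * E ^ 2) := by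
      simp only [hw]; field_simp; linear_combination (-(α:ℂ)) * h2C
    have hcc : (Real.cos lam : ℂ) ≠ 0 := by exact_mod_cast hcos.ne'
    rw [h1]; simp only [hw]
    generalize (Real.cos lam : ℂ) = cc at *
    field_simp
  rw [hrel]
  set m := -(x:ℂ) + (1 - x) * (2 * (w z / (1 - w z))) with hmdef
  have : ((α:ℂ) - 1) - x * α * (Real.cos lam * E) + (1 - x) * (α * ((Real.cos lam : ℂ) * E) * (2 * (w z / (1 - w z))))
    = ((α - 1 : ℝ):ℂ) + ((α * Real.cos lam : ℝ) : ℂ) * (E * m) := by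
    rw [hmdef]; push_cast; ring
  rw [this]
  refine (norm_add_le _ _).trans ?_
  rw [norm_mul, norm_mul, hEn, Complex.norm_real, Complex.norm_real, Real.norm_eq_abs,
    Real.norm_eq_abs, abs_of_pos (by positivity : 0 < α * Real.cos lam), abs_of_nonpos (by linarith)]
  have : α * Real.cos lam * (1 * ‖m‖) ≤ α * Real.cos lam * (1 * 1) := by gcongr
  linarith

lemma aux_core (lam α : ℝ) (hcos : 0 < Real.cos lam) (hcos2 : Real.cos lam < 1)
    (hα : 0 < α) (hα1 : α ≤ 1)
    (f P Q : ℂ → ℂ) (hf : DifferentiableOn ℂ f (ball 0 1)) (hP : DifferentiableOn ℂ P (ball 0 1))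
    (hQ : DifferentiableOn ℂ Q (ball 0 1))
    (hf0 : f 0 = 0) (hf1 : deriv f 0 = 1) (hP0 : P 0 = 1)
    (hfne : ∀ z ∈ ball (0 : ℂ) 1, z ≠ 0 → f z ≠ 0)
    (hfP : ∀ z ∈ ball (0 : ℂ) 1, z * deriv f z = f z * P z)
    (hPQ : ∀ z ∈ ball (0 : ℂ) 1, z * deriv P z = P z * Q z - α * P z ^ 2)
    (hQ0 : Q 0 = α) (hQ1 : deriv Q 0 = 0)
    (hre : ∀ z ∈ ball (0:ℂ) 1, 0 < (Complex.exp (-(lam : ℂ) * Complex.I) * Q z).re) :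
    Set.InjOn f (ball (0 : ℂ) 1) := by
  have hsb := aux_Q lam α hcos hα hα1 Q hQ hQ0 hQ1 hre
  set C : ℂ := Real.cos lam * Complex.exp (lam * Complex.I) with hC
  have hCn : ‖C‖ < 1 := by
    rw [hC, norm_mul, Complex.norm_exp_ofReal_mul_I, Complex.norm_real, Real.norm_eq_abs, abs_of_pos hcos]
    simpa using hcos2
  have hC1 : 1 - C ≠ 0 := by
    intro h
    rw [← sub_eq_zero.mp h] at hCn
    simp at hCn
  set κ : ℝ := 1 - α + α * Real.cos lam with hκ
  have hκ1 : κ < 1 := by rw [hκ]; nlinarith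
  have hα0 : (α:ℂ) ≠ 0 := by exact_mod_cast hα.ne'
  have h0mem : (0:ℂ) ∈ ball (0:ℂ) 1 := by simp
  obtain ⟨δ, hδ, hloc⟩ := aux_localinj f P ((α:ℂ)⁻¹) (hf.analyticAt (isOpen_ball.mem_nhds h0mem))
    (hP.analyticAt (isOpen_ball.mem_nhds h0mem)) hf0 hf1 hP0
  -- choice of the final time
  obtain ⟨T, hT, hT1, hT2⟩ : ∃ T : ℝ, 0 < T ∧ Real.exp (-T) < δ ∧
      ‖(1 - C) / (Complex.exp (2 * T) - 1)‖ < δ := by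
    have l1 : Filter.Tendsto (fun T : ℝ => Real.exp (-T)) Filter.atTop (nhds 0) :=
      Real.tendsto_exp_neg_atTop_nhds_zero
    have l2 : Filter.Tendsto (fun T : ℝ => ‖1 - C‖ / (Real.exp (2 * T) - 1)) Filter.atTop (nhds 0) := by
      apply Filter.Tendsto.const_div_atTop
      apply Filter.tendsto_atTop_add_const_right
      exact Real.tendsto_exp_atTop.comp (Filter.tendsto_id.const_mul_atTop (by norm_num))
    obtain ⟨T, h1, h2, h3⟩ := ((l1.eventually_lt_const hδ).and ((l2.eventually_lt_const hδ).and
      (Filter.eventually_gt_atTop 0))).exists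
    refine ⟨T, h3, h1, ?_⟩
    have e : Complex.exp (2 * T) - 1 = ((Real.exp (2 * T) - 1 : ℝ) : ℂ) := by push_cast; rfl
    have : 1 ≤ Real.exp (2 * T) := Real.one_le_exp (by linarith)
    rw [norm_div, e, Complex.norm_real, Real.norm_eq_abs, abs_of_nonneg (by linarith)]
    exact h2
  set b : ℂ := (1 - C)⁻¹ with hb
  have hb0 : b ≠ 0 := inv_ne_zero hC1
  set h : ℂ := (1 - C) / (Complex.exp (2 * T) - 1) with hh
  have hET : Complex.exp (2 * T) - 1 ≠ 0 := by
    have e : Complex.exp (2 * T) - 1 = ((Real.exp (2 * T) - 1 : ℝ) : ℂ) := by push_cast; rfl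
    rw [e]
    have : 1 < Real.exp (2 * T) := Real.one_lt_exp_iff.mpr (by linarith)
    exact_mod_cast (by linarith : Real.exp (2*T) - 1 ≠ 0)
  have hh0 : h ≠ 0 := div_ne_zero hC1 hET
  obtain ⟨hslit, hinj⟩ := hloc h hT2
  -- the vector field
  set s : ℝ → ℂ → ℂ := fun t z => ((α:ℂ) - 1) - (Real.exp (-t) ^ 2 : ℝ) * α * C
    + (1 - (Real.exp (-t) ^ 2 : ℝ)) * (Q ((Real.exp (-t) : ℝ) * z) - α) with hs
  have hmem : ∀ t : ℝ, 0 ≤ t → ∀ z ∈ ball (0:ℂ) 1, ((Real.exp (-t) : ℝ) : ℂ) * z ∈ ball (0:ℂ) 1 := by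
    intro t ht z hz
    have h1 : Real.exp (-t) ≤ 1 := Real.exp_le_one_iff.mpr (by linarith)
    simp only [mem_ball_zero_iff, norm_mul, Complex.norm_real, Real.norm_eq_abs, Real.abs_exp] at hz ⊢
    nlinarith [norm_nonneg z, Real.exp_pos (-t)]
  have hsn : ∀ t : ℝ, 0 ≤ t → ∀ z ∈ ball (0:ℂ) 1, ‖s t z‖ ≤ κ := by
    intro t ht z hz
    have h1 : Real.exp (-t) ≤ 1 := Real.exp_le_one_iff.mpr (by linarith)
    have h0 := Real.exp_pos (-t)
    refine hsb (Real.exp (-t) ^ 2) (by nlinarith) _ (hmem t ht z hz) ?_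
    have hz' : ‖z‖ < 1 := by simpa using hz
    rw [norm_mul, Complex.norm_real, Real.norm_eq_abs, Real.abs_exp, mul_pow]
    have : ‖z‖ ^ 2 ≤ 1 := by nlinarith [norm_nonneg z]
    nlinarith [sq_nonneg (Real.exp (-t))]
  have hs1 : ∀ t : ℝ, 0 ≤ t → ∀ z ∈ ball (0:ℂ) 1, 1 - κ ≤ ‖1 + s t z‖ := by
    intro t ht z hz
    have := norm_sub_norm_le (1:ℂ) (-(s t z))
    rw [norm_one, norm_neg, sub_neg_eq_add] at this
    linarith [hsn t ht z hz]
  have hs1' : ∀ t : ℝ, 0 ≤ t → ∀ z ∈ ball (0:ℂ) 1, 1 + s t z ≠ 0 := by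
    intro t ht z hz h
    have := hs1 t ht z hz
    rw [h, norm_zero] at this; linarith
  set g : ℝ → ℂ → ℂ := fun t z => (s t z - 1) / (1 + s t z) with hg
  have hsd : ∀ t : ℝ, 0 ≤ t → DifferentiableOn ℂ (s t) (ball 0 1) := by
    intro t ht
    have : DifferentiableOn ℂ (fun z => Q ((Real.exp (-t) : ℝ) * z)) (ball 0 1) :=
      hQ.comp (by fun_prop) (fun z hz => hmem t ht z hz)
    simp only [hs]
    exact ((this.sub_const _).const_mul _).const_add _
  -- reduce to a smaller disk
  intro z1 hz1 z2 hz2 hfz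
  by_cases h10 : z1 = 0
  · by_contra hne
    subst h10
    exact hfne z2 hz2 (fun h => hne h.symm) (by rw [← hfz, hf0])
  by_cases h20 : z2 = 0
  · subst h20
    exact absurd (by rw [hfz, hf0]) (hfne z1 hz1 h10)
  obtain ⟨ρ, hρm, hρ1⟩ := exists_between (max_lt (by simpa using hz1 : ‖z1‖ < 1) (by simpa using hz2 : ‖z2‖ < 1))
  have hρz1 : ‖z1‖ < ρ := (le_max_left _ _).trans_lt hρm
  have hρz2 : ‖z2‖ < ρ := (le_max_right _ _).trans_lt hρm
  have hρ0 : 0 < ρ := (norm_nonneg _).trans_lt hρz1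
  obtain ⟨Φ, hΦ, hΦc, hΦi⟩ := aux_flow g ((κ + 1) / (1 - κ)) T ρ hT hρ0 hρ1
    (fun t ht => ((hsd t ht.1).sub_const _).div ((hsd t ht.1).const_add _) (hs1' t ht.1))
    (fun t ht z hz => by
      simp only [hg, norm_div]
      have h1 := hsn t ht.1 z hz
      have h2 := hs1 t ht.1 z hz
      have h3 : ‖s t z - 1‖ ≤ κ + 1 := by
        refine (norm_sub_le _ _).trans ?_
        rw [norm_one]; linarith
      have : 0 < 1 - κ := by linarith
      have : 0 ≤ κ := (norm_nonneg _).trans h1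
      gcongr)
    (fun t ht z hz => by
      have h1 := hsn t ht.1 z hz
      have h2 : ‖s t z‖ ^ 2 ≤ 1 := by nlinarith [norm_nonneg (s t z)]
      rw [← Complex.normSq_eq_norm_sq, Complex.normSq_apply] at h2
      simp only [hg, Complex.div_re]
      rw [← add_div]
      apply div_nonpos_of_nonpos_of_nonneg _ (Complex.normSq_nonneg _)
      simp
      nlinarith)
    (fun z hz => by
      have hsc : ContinuousOn (fun t => s t z) (Set.Icc 0 T) := by
        have : ContinuousOn (fun t : ℝ => Q ((Real.exp (-t) : ℝ) * z)) (Set.Icc 0 T) :=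
          hQ.continuousOn.comp (by fun_prop) (fun t ht => hmem t ht.1 z hz)
        simp only [hs]
        have hec : ContinuousOn (fun t : ℝ => ((Real.exp (-t) ^ 2 : ℝ) : ℂ)) (Set.Icc 0 T) :=
          (by fun_prop : Continuous (fun t : ℝ => ((Real.exp (-t) ^ 2 : ℝ) : ℂ))).continuousOn
        exact (continuousOn_const.sub ((hec.mul continuousOn_const).mul continuousOn_const)).add
          ((continuousOn_const.sub hec).mul (this.sub continuousOn_const))
      exact (hsc.sub continuousOn_const).div (continuousOn_const.add hsc) (fun t ht => hs1' t ht.1 z hz))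
  -- conservation
  have hcons : ∀ x ∈ closedBall (0:ℂ) ρ, ∃ A : ℂ, f x = f ((Real.exp (-T) : ℝ) * Φ x T) * Complex.exp A ∧
      Complex.exp (α * A) = 1 + b * (Complex.exp (2 * T) - 1) * P ((Real.exp (-T) : ℝ) * Φ x T) := by
    intro x hx
    obtain ⟨hx0, hxd⟩ := hΦ x hx
    have hΦm : ∀ t ∈ Set.Icc 0 T, Φ x t ∈ ball (0:ℂ) 1 := fun t ht => by
      have h1 := (hxd t ht).2
      have h2 : ‖x‖ ≤ ρ := by simpa using hx
      simp; linarith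
    have hζm : ∀ t ∈ Set.Icc 0 T, ((Real.exp (-t) : ℝ) : ℂ) * Φ x t ∈ ball (0:ℂ) 1 :=
      fun t ht => hmem t ht.1 _ (hΦm t ht)
    have hΦcont : ContinuousOn (Φ x) (Set.Icc 0 T) := fun t ht => (hxd t ht).1.continuousWithinAt
    have hed : ∀ t : ℝ, HasDerivAt (fun t : ℝ => ((Real.exp (-t) : ℝ) : ℂ)) (-(Real.exp (-t) : ℝ) : ℂ) t := by
      intro t
      have := ((hasDerivAt_neg t).exp).ofReal_comp
      simpa using this
    have := aux_cons f P Q (deriv f) (deriv P) α b T hT (fun t => (Real.exp (-t) : ℝ) * Φ x t)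
      (fun t => s t (Φ x t)) ?_ ?_ (fun t ht => hs1' t ht.1 _ (hΦm t ht)) ?_
      (fun t ht => (hf.differentiableAt (isOpen_ball.mem_nhds (hζm t ht))).hasDerivAt)
      (fun t ht => hfP _ (hζm t ht))
      (fun t ht => (hP.differentiableAt (isOpen_ball.mem_nhds (hζm t ht))).hasDerivAt)
      (fun t ht => hPQ _ (hζm t ht))
    · simpa [hx0] using this
    · intro t ht
      refine ((hed t).hasDerivWithinAt.mul (hxd t ht).1).congr_deriv ?_
      have := hs1' t ht.1 _ (hΦm t ht)
      simp only [hg]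
      field_simp
      ring
    · have : ContinuousOn (fun t : ℝ => Q ((Real.exp (-t) : ℝ) * Φ x t)) (Set.Icc 0 T) :=
        hQ.continuousOn.comp ((by fun_prop : Continuous (fun t : ℝ => ((Real.exp (-t) : ℝ) : ℂ))).continuousOn.mul hΦcont) hζm
      simp only [hs]
      have hec : ContinuousOn (fun t : ℝ => ((Real.exp (-t) ^ 2 : ℝ) : ℂ)) (Set.Icc 0 T) :=
        (by fun_prop : Continuous (fun t : ℝ => ((Real.exp (-t) ^ 2 : ℝ) : ℂ))).continuousOn
      exact (continuousOn_const.sub ((hec.mul continuousOn_const).mul continuousOn_const)).add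
        ((continuousOn_const.sub hec).mul (this.sub continuousOn_const))
    · intro t ht
      simp only [hs]
      generalize Q ((Real.exp (-t) : ℝ) * Φ x t) = q
      have hx : ((Real.exp (-t) ^ 2 : ℝ) : ℂ) * Complex.exp (2 * t) = 1 := by
        push_cast
        rw [← Complex.exp_nat_mul, ← Complex.exp_add]
        simp
      generalize ((Real.exp (-t) ^ 2 : ℝ) : ℂ) = y at hx ⊢
      generalize Complex.exp (2 * t) = e at hx ⊢
      rw [hb]
      field_simp
      linear_combination (α - α * C - q) * hx
  -- the final map
  set Z : ℂ → ℂ := fun x => (Real.exp (-T) : ℝ) * Φ x T with hZ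
  have hZm : ∀ x ∈ closedBall (0:ℂ) ρ, Z x ∈ ball (0:ℂ) δ ∧ Z x ∈ ball (0:ℂ) 1 := by
    intro x hx
    have h1 := ((hΦ x hx).2 T ⟨hT.le, le_rfl⟩).2
    have h2 : ‖x‖ ≤ ρ := by simpa using hx
    refine ⟨?_, hmem T hT.le _ (by simp; linarith)⟩
    simp only [hZ, mem_ball_zero_iff, norm_mul, Complex.norm_real, Real.norm_eq_abs, Real.abs_exp]
    have : Real.exp (-T) * ‖Φ x T‖ ≤ Real.exp (-T) * 1 := by gcongr; linarith
    linarith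
  have hZc : ContinuousOn Z (closedBall 0 ρ) := continuousOn_const.mul hΦc
  set G : ℂ → ℂ := fun z => f z * Complex.exp ((α:ℂ)⁻¹ * Complex.log (P z + h)) with hG
  set R : ℂ → ℂ := fun x => G (Z x) / f x with hR
  have hsub : ball (0:ℂ) ρ \ {0} ⊆ closedBall 0 ρ := Set.sdiff_subset.trans ball_subset_closedBall
  have hsub1 : closedBall (0:ℂ) ρ ⊆ ball 0 1 := closedBall_subset_ball hρ1
  have hRc : ContinuousOn R (ball (0:ℂ) ρ \ {0}) := by
    refine ContinuousOn.div ?_ (hf.continuousOn.mono (hsub.trans hsub1)) (fun x hx => hfne x (hsub1 (hsub hx)) hx.2)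
    have hfc : ContinuousOn (fun x => f (Z x)) (ball (0:ℂ) ρ \ {0}) :=
      hf.continuousOn.comp (hZc.mono hsub) (fun x hx => (hZm x (hsub hx)).2)
    have hPc : ContinuousOn (fun x => P (Z x)) (ball (0:ℂ) ρ \ {0}) :=
      hP.continuousOn.comp (hZc.mono hsub) (fun x hx => (hZm x (hsub hx)).2)
    exact hfc.mul ((continuousOn_const.mul ((hPc.add continuousOn_const).clog
      (fun x hx => hslit _ (hZm x (hsub hx)).1))).cexp)
  have hRm : R '' (ball (0:ℂ) ρ \ {0}) ⊆ {y : ℂ | ∃ X, y = Complex.exp X ∧ Complex.exp (α * X) = h} := by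
    rintro _ ⟨x, hx, rfl⟩
    obtain ⟨A, hA1, hA2⟩ := hcons x (hsub hx)
    have hfx : f x ≠ 0 := hfne x (hsub1 (hsub hx)) hx.2
    have hne : P (Z x) + h ≠ 0 := Complex.slitPlane_ne_zero (hslit _ (hZm x (hsub hx)).1)
    have hfZ : f (Z x) ≠ 0 := fun h0 => hfx (by rw [hA1]; simp only [hZ] at h0; rw [h0, zero_mul])
    refine ⟨(α:ℂ)⁻¹ * Complex.log (P (Z x) + h) - A, ?_, ?_⟩
    · simp only [hR, hG]
      rw [hA1, Complex.exp_sub]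
      change _ / (f (Z x) * _) = _
      have := Complex.exp_ne_zero A
      field_simp
    · rw [mul_sub, Complex.exp_sub, hA2, mul_inv_cancel_left₀ hα0, Complex.exp_log hne]
      change _ / (1 + b * (Complex.exp (2 * T) - 1) * P (Z x)) = _
      have e : 1 + b * (Complex.exp (2 * T) - 1) * P (Z x) = h⁻¹ * (P (Z x) + h) := by
        rw [mul_add, inv_mul_cancel₀ hh0, hh, hb, inv_div]; ring
      rw [e]
      field_simp
  have hsing := (aux_count α h hα0 hh0).isTotallyDisconnected _ hRm ((aux_conn ρ).image R hRc)
  have hm1 : z1 ∈ ball (0:ℂ) ρ \ {0} := ⟨by simpa using hρz1, h10⟩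
  have hm2 : z2 ∈ ball (0:ℂ) ρ \ {0} := ⟨by simpa using hρz2, h20⟩
  have hRe : R z1 = R z2 := hsing ⟨z1, hm1, rfl⟩ ⟨z2, hm2, rfl⟩
  have hGe : G (Z z1) = G (Z z2) := by
    simp only [hR] at hRe
    rw [hfz] at hRe
    have := hfne z2 hz2 h20
    field_simp at hRe
    exact hRe
  have hZe := hinj (hZm z1 (hsub hm1)).1 (hZm z2 (hsub hm2)).1 hGe
  refine hΦi (hsub hm1) (hsub hm2) ?_
  have he : ((Real.exp (-T) : ℝ) : ℂ) ≠ 0 := by exact_mod_cast (Real.exp_pos _).ne'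
  exact mul_left_cancel₀ he hZe
/-- If `0 < cos λ < 1`, `−1 < q ≤ 0`, `f''(0) = 0` and `Re(e^{−iλ}(1 + zf''/f' + q·zf'/f)) > 0` on 𝔻, then `f` is univalent. -/
theorem univalence_q_nonpos_second_deriv_zero (lam : ℝ)
    (hlam : lam ∈ Set.Ioo (-(Real.pi / 2)) (Real.pi / 2))
    (hcos : 0 < Real.cos lam) (hcos2 : Real.cos lam < 1)
    (q : ℝ) (hq : q ∈ Set.Ioc (-1 : ℝ) 0)
    (f : ℂ → ℂ)
    (hf : DifferentiableOn ℂ f (ball (0 : ℂ) 1))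
    (hf0 : f 0 = 0) (hf'0 : deriv f 0 = 1)
    (hf''0 : deriv (deriv f) 0 = 0)
    (hf' : ∀ z ∈ ball (0 : ℂ) 1, deriv f z ≠ 0)
    (hfne : ∀ z ∈ ball (0 : ℂ) 1, z ≠ 0 → f z ≠ 0)
    (hcond : ∀ z ∈ ball (0 : ℂ) 1,
      0 < (Complex.exp (-(lam : ℂ) * Complex.I) *
        (1 + z * deriv (deriv f) z / deriv f z +
          (q : ℂ) * (if z = 0 then 1 else z * deriv f z / f z))).re) :
    Set.InjOn f (ball (0 : ℂ) 1) := by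
  have ho : IsOpen (ball (0:ℂ) 1) := isOpen_ball
  have h0 : (0:ℂ) ∈ ball (0:ℂ) 1 := by simp
  set k : ℂ → ℂ := dslope f 0 with hk
  have hkd : DifferentiableOn ℂ k (ball 0 1) :=
    (Complex.differentiableOn_dslope (ho.mem_nhds h0)).mpr hf
  have hfk : ∀ z, f z = z * k z := by
    intro z
    have := sub_smul_dslope f 0 z
    simpa [hf0] using this.symm
  have hk0 : k 0 = 1 := by simp [hk, hf'0]
  have hkne : ∀ z ∈ ball (0:ℂ) 1, k z ≠ 0 := by
    intro z hz h
    by_cases hz0 : z = 0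
    · rw [hz0, hk0] at h; exact one_ne_zero h
    · exact hfne z hz hz0 (by rw [hfk, h, mul_zero])
  have hd1 : DifferentiableOn ℂ (deriv f) (ball 0 1) := hf.deriv ho
  have hd2 : DifferentiableOn ℂ (deriv (deriv f)) (ball 0 1) := hd1.deriv ho
  have hkat : ∀ z ∈ ball (0:ℂ) 1, HasDerivAt k (deriv k z) z := fun z hz =>
    (hkd.differentiableAt (ho.mem_nhds hz)).hasDerivAt
  have h1at : ∀ z ∈ ball (0:ℂ) 1, HasDerivAt (deriv f) (deriv (deriv f) z) z := fun z hz =>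
    (hd1.differentiableAt (ho.mem_nhds hz)).hasDerivAt
  have hfd : ∀ z ∈ ball (0:ℂ) 1, deriv f z = k z + z * deriv k z := by
    intro z hz
    have h1 := (hasDerivAt_id z).mul (hkat z hz)
    have h2 : f = id * k := by funext z; simp [hfk z]
    have h3 := h1.deriv
    rw [← h2] at h3
    simpa using h3
  have hk1 : deriv k 0 = 0 := by
    have hkk : DifferentiableOn ℂ (deriv k) (ball 0 1) := hkd.deriv ho
    have h1 := (hkat 0 h0).add ((hasDerivAt_id (0:ℂ)).mul
      (hkk.differentiableAt (ho.mem_nhds h0)).hasDerivAt)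
    have h2 : deriv f =ᶠ[nhds 0] (k + id * deriv k) := by
      filter_upwards [ho.mem_nhds h0] with z hz
      simp [hfd z hz]
    have h3 := (h1.congr_of_eventuallyEq h2).deriv
    rw [hf''0] at h3
    simp at h3
    linear_combination (-1/2 : ℂ) * h3
  set P : ℂ → ℂ := fun z => deriv f z / k z with hP
  have hPat : ∀ z ∈ ball (0:ℂ) 1,
      HasDerivAt P ((deriv (deriv f) z * k z - deriv f z * deriv k z) / k z ^ 2) z :=
    fun z hz => (h1at z hz).div (hkat z hz) (hkne z hz)
  set Q : ℂ → ℂ := fun z => 1 + z * deriv (deriv f) z / deriv f z + (q:ℂ) * P z with hQ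
  have hPd : DifferentiableOn ℂ P (ball 0 1) := hd1.div hkd hkne
  have hQd : DifferentiableOn ℂ Q (ball 0 1) :=
    (((differentiableOn_id.mul hd2).div hd1 hf').const_add 1).add (hPd.const_mul _)
  have hP0 : P 0 = 1 := by simp [hP, hf'0, hk0]
  refine aux_core lam (1 + q) hcos hcos2 (by linarith [hq.1]) (by linarith [hq.2]) f P Q hf hPd hQd
    hf0 hf'0 hP0 hfne ?_ ?_ ?_ ?_ ?_
  · intro z hz
    have := hkne z hz
    simp only [hP]
    rw [hfk z]; field_simp
  · intro z hz
    have h1 := hkne z hz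
    have h2 := hf' z hz
    have h3 := hfd z hz
    rw [(hPat z hz).deriv]
    simp only [hQ, hP]
    push_cast
    field_simp
    linear_combination (deriv f z) * h3
  · simp [hQ, hP0]
  · have h1 := ((((hasDerivAt_id (0:ℂ)).mul (hd2.differentiableAt (ho.mem_nhds h0)).hasDerivAt).div
      (h1at 0 h0) (hf' 0 h0)).const_add 1).add ((hPat 0 h0).const_mul (q:ℂ))
    have h2 := h1.deriv
    have e : Q = ((fun x => 1 + ((id * deriv (deriv f) / deriv f : ℂ → ℂ)) x) + fun y => (q:ℂ) * P y) := rfl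
    rw [e, h2]
    simp [hf''0, hk1]
  · intro z hz
    have h1 := hcond z hz
    have h2 : (if z = 0 then 1 else z * deriv f z / f z) = P z := by
      split_ifs with hz0
      · rw [hz0, hP0]
      · simp only [hP]
        have := hkne z hz
        rw [hfk z]; field_simp
    rw [h2] at h1
    exact h1
end
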